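/- arXiv:1206.6173 — 2 statements merged into one kernel-verified Lean document; each statement's English description precedes it below -/
import Mathlib

section
/- Let (m; e, f) be a pseudo-product fundamental graded Lie algebra of the μ-th kind over ℂ with μ ≥ 2, let c = {X ∈ g_{-1} : [X, g_{-2}] = 0} be the centralizer of g_{-2} in g_{-1}, and let g = ⊕_{p∈ℤ} g_p be the prolongation of (m; e, f). Assume g_0 is isomorphic to gl(e) ⊕ gl(f) as a Lie algebra. Then: (1) if μ = 2, then (m; e, f) is a free pseudo-product FGLA; (2) if μ ≥ 3 and c ≠ 0, then (m; e, f) is not a free pseudo-product FGLA; (3) if μ = 3 and c = 0, then (m; e, f) is a free pseudo-product FGLA. -/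
open scoped TensorProduct

/-- A ℤ-graded Lie algebra (GLA) structure over `ℂ` on a Lie algebra `L`:
a family of finite-dimensional subspaces forming an internal direct sum and
compatible with the bracket. -/
structure GLA (L : Type) [LieRing L] [LieAlgebra ℂ L] : Type where
  g : ℤ → Submodule ℂ L
  internal : DirectSum.IsInternal g
  bracket_mem : ∀ p q : ℤ, ∀ x ∈ g p, ∀ y ∈ g q, ⁅x, y⁆ ∈ g (p + q)
  findim : ∀ p : ℤ, FiniteDimensional ℂ (g p)

namespace GLA

variable {L : Type} [LieRing L] [LieAlgebra ℂ L]

/-- A GLA is a fundamental graded Lie algebra (FGLA): it is finite-dimensional,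
concentrated in negative degrees, `g₋₁ ≠ 0`, and it is generated by `g₋₁`
(i.e. `g_{p-1} = [g_p, g₋₁]` for all `p < 0`). -/
structure IsFGLA (G : GLA L) : Prop where
  fd : FiniteDimensional ℂ L
  nonneg : ∀ p : ℤ, 0 ≤ p → G.g p = ⊥
  neg_one_ne_bot : G.g (-1) ≠ ⊥
  generated : ∀ p : ℤ, p < 0 →
    G.g (p - 1) = Submodule.span ℂ {z : L | ∃ x ∈ G.g p, ∃ y ∈ G.g (-1), z = ⁅x, y⁆}

/-- A GLA is of the `μ`-th kind (equivalently, of depth `μ`). -/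
def IsOfKind (G : GLA L) (μ : ℕ) : Prop :=
  G.g (-(μ : ℤ)) ≠ ⊥ ∧ ∀ p : ℤ, p < -(μ : ℤ) → G.g p = ⊥

/-- Transitivity of a GLA. -/
def Transitive (G : GLA L) : Prop :=
  ∀ p : ℤ, 0 ≤ p → ∀ x ∈ G.g p,
    (∀ q : ℤ, q < 0 → ∀ y ∈ G.g q, ⁅x, y⁆ = 0) → x = 0

end GLA

/-- `G` is a free fundamental graded Lie algebra of type `(n, μ)`:
it is an FGLA of the `μ`-th kind with `dim g₋₁ = n`, and every surjective linear map
from `g₋₁` onto the degree `-1` part of an FGLA of the `μ`-th kind extends uniquely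
to a graded Lie algebra epimorphism. -/
def IsFreeFGLA {L : Type} [LieRing L] [LieAlgebra ℂ L] (G : GLA L) (n μ : ℕ) : Prop :=
  G.IsFGLA ∧ G.IsOfKind μ ∧ Module.finrank ℂ (G.g (-1)) = n ∧
  ∀ (L' : Type) [LieRing L'] [LieAlgebra ℂ L'] (G' : GLA L'),
    G'.IsFGLA → G'.IsOfKind μ →
    ∀ φ : (G.g (-1)) →ₗ[ℂ] (G'.g (-1)), Function.Surjective φ →
      ∃! Φ : L →ₗ⁅ℂ⁆ L',
        (∀ p : ℤ, ∀ x ∈ G.g p, Φ x ∈ G'.g p) ∧ Function.Surjective Φ ∧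
        ∀ x : G.g (-1), Φ (x : L) = (φ x : L')

/-- A pseudo-product FGLA: an FGLA together with nonzero subspaces `e`, `f` with
`g₋₁ = e ⊕ f` and `[e,e] = [f,f] = 0`. -/
structure IsPPFGLA {L : Type} [LieRing L] [LieAlgebra ℂ L]
    (G : GLA L) (e f : Submodule ℂ L) : Prop where
  fgla : G.IsFGLA
  e_ne_bot : e ≠ ⊥
  f_ne_bot : f ≠ ⊥
  sup_eq : e ⊔ f = G.g (-1)
  inf_eq : e ⊓ f = ⊥
  lie_ee : ∀ x ∈ e, ∀ y ∈ e, ⁅x, y⁆ = (0 : L)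
  lie_ff : ∀ x ∈ f, ∀ y ∈ f, ⁅x, y⁆ = (0 : L)

/-- `(G; e, f)` is a free pseudo-product FGLA of type `(m, n, μ)`. -/
def IsFreePPFGLA {L : Type} [LieRing L] [LieAlgebra ℂ L] (G : GLA L)
    (e f : Submodule ℂ L) (m n μ : ℕ) : Prop :=
  IsPPFGLA G e f ∧ G.IsOfKind μ ∧
  Module.finrank ℂ e = m ∧ Module.finrank ℂ f = n ∧
  ∀ (L' : Type) [LieRing L'] [LieAlgebra ℂ L'] (G' : GLA L') (e' f' : Submodule ℂ L'),
    IsPPFGLA G' e' f' → G'.IsOfKind μ →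
    ∀ φ : (G.g (-1)) →ₗ[ℂ] (G'.g (-1)), Function.Surjective φ →
      (∀ x : L, ∀ hx : x ∈ G.g (-1), x ∈ e → (φ ⟨x, hx⟩ : L') ∈ e') →
      (∀ x : L, ∀ hx : x ∈ G.g (-1), x ∈ f → (φ ⟨x, hx⟩ : L') ∈ f') →
      ∃! Φ : L →ₗ⁅ℂ⁆ L',
        (∀ p : ℤ, ∀ x ∈ G.g p, Φ x ∈ G'.g p) ∧ Function.Surjective Φ ∧
        ∀ x : G.g (-1), Φ (x : L) = (φ x : L')

/-- `G` (on `LG`, with embedding `ι` of `Lm`) is the prolongation of the FGLA `M`: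
`ι` embeds `M` as the negative part of `G`, `G` is transitive, and `G` is maximal among
transitive GLAs with negative part `M`. -/
structure IsProlongation {Lm LG : Type} [LieRing Lm] [LieAlgebra ℂ Lm]
    [LieRing LG] [LieAlgebra ℂ LG] (M : GLA Lm) (G : GLA LG)
    (ι : Lm →ₗ⁅ℂ⁆ LG) : Prop where
  inj : Function.Injective ι
  graded_neg : ∀ p : ℤ, p < 0 → (M.g p).map ι.toLinearMap = G.g p
  trans : G.Transitive
  max : ∀ (LH : Type) [LieRing LH] [LieAlgebra ℂ LH] (H : GLA LH) (j : Lm →ₗ⁅ℂ⁆ LH),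
    Function.Injective j → (∀ p : ℤ, p < 0 → (M.g p).map j.toLinearMap = H.g p) →
    H.Transitive →
    ∃ ψ : LH →ₗ⁅ℂ⁆ LG, Function.Injective ψ ∧
      (∀ p : ℤ, (H.g p).map ψ.toLinearMap ≤ G.g p) ∧ ψ.comp j = ι

/-- `G` (with embedding `ι`) is the prolongation of the pseudo-product FGLA `(M; e, f)`:
the negative part is `M`, `G` is transitive, the degree-0 part preserves `e` and `f`,
and `G` is maximal among such transitive GLAs. -/
structure IsPPProlongation {Lm LG : Type} [LieRing Lm] [LieAlgebra ℂ Lm]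
    [LieRing LG] [LieAlgebra ℂ LG] (M : GLA Lm) (e f : Submodule ℂ Lm) (G : GLA LG)
    (ι : Lm →ₗ⁅ℂ⁆ LG) : Prop where
  inj : Function.Injective ι
  graded_neg : ∀ p : ℤ, p < 0 → (M.g p).map ι.toLinearMap = G.g p
  trans : G.Transitive
  e_stable : ∀ x ∈ G.g 0, ∀ y ∈ e, ⁅x, ι y⁆ ∈ e.map ι.toLinearMap
  f_stable : ∀ x ∈ G.g 0, ∀ y ∈ f, ⁅x, ι y⁆ ∈ f.map ι.toLinearMap
  max : ∀ (LH : Type) [LieRing LH] [LieAlgebra ℂ LH] (H : GLA LH) (j : Lm →ₗ⁅ℂ⁆ LH),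
    Function.Injective j → (∀ p : ℤ, p < 0 → (M.g p).map j.toLinearMap = H.g p) →
    H.Transitive →
    (∀ x ∈ H.g 0, ∀ y ∈ e, ⁅x, j y⁆ ∈ e.map j.toLinearMap) →
    (∀ x ∈ H.g 0, ∀ y ∈ f, ⁅x, j y⁆ ∈ f.map j.toLinearMap) →
    ∃ ψ : LH →ₗ⁅ℂ⁆ LG, Function.Injective ψ ∧
      (∀ p : ℤ, (H.g p).map ψ.toLinearMap ≤ G.g p) ∧ ψ.comp j = ι

/-- `G` is a finite-dimensional simple graded Lie algebra of type `(A, Pi1)`, where `A`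
is the Cartan matrix (with convention `⁅hᵢ, eⱼ⁆ = Aᵢⱼ • eⱼ`) and `Pi1` is the set of
simple roots of degree one: there is a set of Chevalley generators compatible with the
grading, the generators `eᵢ` (resp. `fᵢ`) having degree `1` (resp. `-1`) for `i ∈ Pi1`
and degree `0` otherwise. -/
def IsSimpleGLAOfType {LG : Type} [LieRing LG] [LieAlgebra ℂ LG] (G : GLA LG)
    {l : ℕ} (A : Matrix (Fin l) (Fin l) ℤ) (Pi1 : Finset (Fin l)) : Prop :=
  FiniteDimensional ℂ LG ∧ LieAlgebra.IsSimple ℂ LG ∧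
  ∃ h e f : Fin l → LG,
    LinearIndependent ℂ h ∧ (∀ i, e i ≠ 0) ∧ (∀ i, f i ≠ 0) ∧
    (∀ i j, ⁅h i, h j⁆ = 0) ∧
    (∀ i, ⁅e i, f i⁆ = h i) ∧ (∀ i j, i ≠ j → ⁅e i, f j⁆ = 0) ∧
    (∀ i j, ⁅h i, e j⁆ = A i j • e j) ∧
    (∀ i j, ⁅h i, f j⁆ = (-(A i j)) • f j) ∧
    LieSubalgebra.lieSpan ℂ LG (Set.range e ∪ Set.range f) = ⊤ ∧
    (∀ i, h i ∈ G.g 0) ∧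
    (∀ i, e i ∈ G.g (if i ∈ Pi1 then 1 else 0)) ∧
    (∀ i, f i ∈ G.g (-(if i ∈ Pi1 then 1 else 0)))

/-- The Cartan matrix of type `A_l` (Bourbaki numbering, 0-indexed). -/
def cartanA (l : ℕ) : Matrix (Fin l) (Fin l) ℤ :=
  Matrix.of fun i j =>
    if i = j then 2
    else if (i : ℕ) + 1 = (j : ℕ) ∨ (j : ℕ) + 1 = (i : ℕ) then -1 else 0

/-- The Cartan matrix of type `B_l` (Bourbaki numbering, 0-indexed; the last simple
root is the short one), with convention `⁅hᵢ, eⱼ⁆ = Aᵢⱼ • eⱼ`, i.e. `Aᵢⱼ = αⱼ(hᵢ)`. -/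
def cartanB (l : ℕ) : Matrix (Fin l) (Fin l) ℤ :=
  Matrix.of fun i j =>
    if i = j then 2
    else if (i : ℕ) = l - 1 ∧ (j : ℕ) + 1 = (i : ℕ) then -2
    else if (i : ℕ) + 1 = (j : ℕ) ∨ (j : ℕ) + 1 = (i : ℕ) then -1 else 0

/-- The Cartan matrix of type `G₂` (Bourbaki numbering, 0-indexed; `α₁` is the short
root), with convention `⁅hᵢ, eⱼ⁆ = Aᵢⱼ • eⱼ`, i.e. `Aᵢⱼ = αⱼ(hᵢ)`. -/
def cartanG2 : Matrix (Fin 2) (Fin 2) ℤ := !![2, -3; -1, 2]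

/-- A pseudo-product graded Lie algebra: a transitive GLA whose negative part is an
FGLA equipped with a pseudo-product structure `(e, f)` preserved by `g₀`. -/
structure IsPseudoProductGLA {L : Type} [LieRing L] [LieAlgebra ℂ L]
    (G : GLA L) (e f : Submodule ℂ L) : Prop where
  trans : G.Transitive
  e_ne_bot : e ≠ ⊥
  f_ne_bot : f ≠ ⊥
  sup_eq : e ⊔ f = G.g (-1)
  inf_eq : e ⊓ f = ⊥
  lie_ee : ∀ x ∈ e, ∀ y ∈ e, ⁅x, y⁆ = (0 : L)
  lie_ff : ∀ x ∈ f, ∀ y ∈ f, ⁅x, y⁆ = (0 : L)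
  neg_one_ne_bot : G.g (-1) ≠ ⊥
  generated : ∀ p : ℤ, p < 0 →
    G.g (p - 1) = Submodule.span ℂ {z : L | ∃ x ∈ G.g p, ∃ y ∈ G.g (-1), z = ⁅x, y⁆}
  depth_bdd : ∃ μ : ℕ, ∀ p : ℤ, p < -(μ : ℤ) → G.g p = ⊥
  e_stable : ∀ x ∈ G.g 0, ∀ y ∈ e, ⁅x, y⁆ ∈ e
  f_stable : ∀ x ∈ G.g 0, ∀ y ∈ f, ⁅x, y⁆ ∈ f

/-- The symmetric square `S²(V)` of a vector space, realized as the subspace of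
symmetric tensors in `V ⊗ V`. -/
noncomputable def symSq (V : Type) [AddCommGroup V] [Module ℂ V] : Submodule ℂ (TensorProduct ℂ V V) :=
  LinearMap.eqLocus (TensorProduct.comm ℂ V V).toLinearMap LinearMap.id

lemma tmul_self_mem_symSq {V : Type} [AddCommGroup V] [Module ℂ V] (x : V) :
    x ⊗ₜ[ℂ] x ∈ symSq V := by
  show (TensorProduct.comm ℂ V V).toLinearMap (x ⊗ₜ[ℂ] x) = LinearMap.id (x ⊗ₜ[ℂ] x)
  simp
section BracketTensor

variable {L LG L' E F V : Type} [LieRing L] [LieAlgebra ℂ L] [LieRing LG] [LieAlgebra ℂ LG]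
  [LieRing L'] [LieAlgebra ℂ L'] [AddCommGroup E] [Module ℂ E] [AddCommGroup F] [Module ℂ F]
  [AddCommGroup V] [Module ℂ V]

/-- The linear map `E ⊗ V → L` induced by `(x, v) ↦ ⁅i x, q v⁆`. -/
noncomputable def bracketTensor (i : E →ₗ[ℂ] L) (q : V →ₗ[ℂ] L) : E ⊗[ℂ] V →ₗ[ℂ] L :=
  TensorProduct.lift (LinearMap.mk₂ ℂ (fun x v => ⁅i x, q v⁆) (by simp) (by simp) (by simp)
    (by simp))

@[simp]
lemma bracketTensor_tmul (i : E →ₗ[ℂ] L) (q : V →ₗ[ℂ] L) (x : E) (v : V) :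
    bracketTensor i q (x ⊗ₜ v) = ⁅i x, q v⁆ := by
  simp [bracketTensor]

/-- `X` acts on the image of `q` through the endomorphism `C`. -/
def ActsThrough (ι : L →ₗ⁅ℂ⁆ LG) (q : V →ₗ[ℂ] L) (X : LG) (C : Module.End ℂ V) : Prop :=
  ∀ v, ⁅X, ι (q v)⁆ = ι (q (C v))

lemma ActsThrough.bracketTensor {ι : L →ₗ⁅ℂ⁆ LG} {i : E →ₗ[ℂ] L} {q : V →ₗ[ℂ] L} {X : LG}
    {A : Module.End ℂ E} {C : Module.End ℂ V} (hi : ActsThrough ι i X A)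
    (hq : ActsThrough ι q X C) :
    ActsThrough ι (bracketTensor i q) X (A.rTensor V + C.lTensor E) := by
  intro t
  induction t with
  | zero => simp
  | add s t hs ht => simp only [map_add, lie_add, hs, ht]
  | tmul x v => simp [leibniz_lie X, hi x, hq v]

lemma ActsThrough.apply_mem_ker {ι : L →ₗ⁅ℂ⁆ LG} (hι : Function.Injective ι) {q : V →ₗ[ℂ] L}
    {X : LG} {C : Module.End ℂ V} (h : ActsThrough ι q X C) {t : V} (ht : q t = 0) :
    q (C t) = 0 := by
  apply hι
  rw [← h t, ht]
  simp

lemma eq_zero_of_dualDistrib [FiniteDimensional ℂ E] [FiniteDimensional ℂ V] {t : E ⊗[ℂ] V}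
    (h : ∀ (α : Module.Dual ℂ E) (β : Module.Dual ℂ V),
      TensorProduct.dualDistrib ℂ E V (α ⊗ₜ β) t = 0) : t = 0 := by
  rw [← Module.forall_dual_apply_eq_zero_iff ℂ]
  intro γ
  obtain ⟨s, rfl⟩ := (TensorProduct.dualDistribEquiv ℂ E V).surjective γ
  change TensorProduct.dualDistrib ℂ E V s t = 0
  induction s with
  | zero => simp
  | add s₁ s₂ h₁ h₂ => simp [h₁, h₂]
  | tmul α β => exact h α β

lemma map_smulRight_eq (α : Module.Dual ℂ E) (β : Module.Dual ℂ V) (x : E) (v : V)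
    (t : E ⊗[ℂ] V) :
    TensorProduct.map (α.smulRight x) (β.smulRight v) t =
      TensorProduct.dualDistrib ℂ E V (α ⊗ₜ β) t • x ⊗ₜ[ℂ] v := by
  induction t with
  | zero => simp
  | add s t hs ht => simp only [map_add, hs, ht, add_smul]
  | tmul a b => simp [TensorProduct.smul_tmul', TensorProduct.tmul_smul, smul_smul, mul_comm]

/-- If all pairs of endomorphisms are realised, the kernel of `E ⊗ F → L` is trivial as soon as
the map is nonzero. -/
lemma eq_zero_of_bracketTensor_eq_zero [FiniteDimensional ℂ E] [FiniteDimensional ℂ F]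
    {ι : L →ₗ⁅ℂ⁆ LG} (hι : Function.Injective ι) {i : E →ₗ[ℂ] L} {j : F →ₗ[ℂ] L}
    (hact : ∀ A B, ∃ X, ActsThrough ι i X A ∧ ActsThrough ι j X B)
    (hne : ∃ x y, ⁅i x, j y⁆ ≠ 0) {t : E ⊗[ℂ] F} (ht : bracketTensor i j t = 0) : t = 0 := by
  obtain ⟨x, y, hxy⟩ := hne
  refine eq_zero_of_dualDistrib fun α β => ?_
  obtain ⟨X, hX₁, hX₂⟩ := hact (α.smulRight x) 0
  obtain ⟨Y, hY₁, hY₂⟩ := hact 0 (β.smulRight y)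
  have h₁ := (hY₁.bracketTensor hY₂).apply_mem_ker hι ht
  have h₂ := (hX₁.bracketTensor hX₂).apply_mem_ker hι h₁
  have h₃ : (LinearMap.rTensor F (α.smulRight x) + LinearMap.lTensor E (0 : Module.End ℂ F))
      ((LinearMap.rTensor F (0 : Module.End ℂ E) + LinearMap.lTensor E (β.smulRight y)) t) =
      TensorProduct.map (α.smulRight x) (β.smulRight y) t := by
    simp only [LinearMap.lTensor_zero, LinearMap.rTensor_zero, add_zero, zero_add]
    rw [← LinearMap.comp_apply, LinearMap.rTensor_comp_lTensor]
  rw [h₃, map_smulRight_eq, map_smul, bracketTensor_tmul] at h₂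
  exact (smul_eq_zero.mp h₂).resolve_right hxy

/-- If all pairs of endomorphisms are realised, the kernel of `E ⊗ E ⊗ F → L` consists only of the
relations forced by `⁅E, E⁆ = 0`, as soon as the map is nonzero. -/
lemma bracketTensor_bracketTensor_eq_zero [FiniteDimensional ℂ E] [FiniteDimensional ℂ F]
    {ι : L →ₗ⁅ℂ⁆ LG} (hι : Function.Injective ι) {i : E →ₗ[ℂ] L} {j : F →ₗ[ℂ] L}
    (hact : ∀ A B, ∃ X, ActsThrough ι i X A ∧ ActsThrough ι j X B)
    (hcomm : ∀ x y, ⁅i x, i y⁆ = 0) (hne : ∃ x x' y, ⁅i x, ⁅i x', j y⁆⁆ ≠ 0)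
    {i' : E →ₗ[ℂ] L'} {j' : F →ₗ[ℂ] L'} (hcomm' : ∀ x y, ⁅i' x, i' y⁆ = 0)
    {t : E ⊗[ℂ] (E ⊗[ℂ] F)} (ht : bracketTensor i (bracketTensor i j) t = 0) :
    bracketTensor i' (bracketTensor i' j') t = 0 := by
  obtain ⟨x, y, hxy⟩ : ∃ x y, ⁅i x, ⁅i x, j y⁆⁆ ≠ 0 := by
    by_contra! h
    obtain ⟨x, x', y, hne⟩ := hne
    have hsymm : ⁅i x', ⁅i x, j y⁆⁆ = ⁅i x, ⁅i x', j y⁆⁆ := by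
      rw [leibniz_lie, hcomm, zero_lie, zero_add]
    have hsum := h (x + x') y
    simp only [map_add, add_lie, lie_add, h, hsymm, zero_add, add_zero] at hsum
    rw [← two_smul ℂ, smul_eq_zero] at hsum
    exact hne (hsum.resolve_left two_ne_zero)
  have hdiag : ∀ (α : Module.Dual ℂ E) (β : Module.Dual ℂ F),
      TensorProduct.dualDistrib ℂ E (E ⊗[ℂ] F)
        (α ⊗ₜ TensorProduct.dualDistrib ℂ E F (α ⊗ₜ β)) t = 0 := by
    intro α β
    set A : Module.End ℂ E := α.smulRight x
    set B : Module.End ℂ F := β.smulRight y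
    have key : ∀ (A : Module.End ℂ E) (B : Module.End ℂ F) s, bracketTensor i (bracketTensor i j) s = 0 →
        bracketTensor i (bracketTensor i j)
          ((A.rTensor (E ⊗[ℂ] F) + (A.rTensor F + B.lTensor E).lTensor E) s) = 0 := by
      intro A B s hs
      obtain ⟨X, hX₁, hX₂⟩ := hact A B
      exact (hX₁.bracketTensor (hX₁.bracketTensor hX₂)).apply_mem_ker hι hs
    have hB := key 0 B t ht
    have hAA := key A 0 _ (key A 0 _ hB)
    have hA2 := key (A * A) 0 _ hB
    have hop : ∀ s : E ⊗[ℂ] (E ⊗[ℂ] F),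
        (2 : ℂ) • TensorProduct.map A (TensorProduct.map A B) s =
        (A.rTensor (E ⊗[ℂ] F) + (A.rTensor F + (0 : Module.End ℂ F).lTensor E).lTensor E)
          ((A.rTensor (E ⊗[ℂ] F) + (A.rTensor F + (0 : Module.End ℂ F).lTensor E).lTensor E)
            (((0 : Module.End ℂ E).rTensor (E ⊗[ℂ] F) +
              ((0 : Module.End ℂ E).rTensor F + B.lTensor E).lTensor E) s)) -
        ((A * A).rTensor (E ⊗[ℂ] F) +
          ((A * A).rTensor F + (0 : Module.End ℂ F).lTensor E).lTensor E)
            (((0 : Module.End ℂ E).rTensor (E ⊗[ℂ] F) +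
              ((0 : Module.End ℂ E).rTensor F + B.lTensor E).lTensor E) s) := by
      intro s
      induction s with
      | zero => simp
      | add s₁ s₂ h₁ h₂ => simp only [map_add, smul_add, h₁, h₂]; abel
      | tmul a w =>
        induction w with
        | zero => simp
        | add s₁ s₂ h₁ h₂ =>
          simp only [TensorProduct.tmul_add, map_add, smul_add, h₁, h₂]; abel
        | tmul b d =>
          simp only [LinearMap.lTensor_zero, LinearMap.rTensor_zero, add_zero, zero_add,
            LinearMap.add_apply, LinearMap.lTensor_tmul, LinearMap.rTensor_tmul, map_add,
            TensorProduct.map_tmul, Module.End.mul_apply]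
          module
    have h2 : bracketTensor i (bracketTensor i j)
        ((2 : ℂ) • TensorProduct.map A (TensorProduct.map A B) t) = 0 := by
      rw [hop, map_sub, hAA, hA2, sub_zero]
    have hBmap : TensorProduct.map A B =
        (TensorProduct.dualDistrib ℂ E F (α ⊗ₜ β)).smulRight (x ⊗ₜ[ℂ] y) :=
      LinearMap.ext fun s => map_smulRight_eq α β x y s
    rw [hBmap, map_smulRight_eq, map_smul, map_smul, bracketTensor_tmul, bracketTensor_tmul] at h2
    exact (smul_eq_zero.mp ((smul_eq_zero.mp h2).resolve_left two_ne_zero)).resolve_right hxy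
  have hcoord : ∀ (α α' : Module.Dual ℂ E) (β : Module.Dual ℂ F) (s : E ⊗[ℂ] (E ⊗[ℂ] F)),
      TensorProduct.dualDistrib ℂ E (E ⊗[ℂ] F)
        (α ⊗ₜ TensorProduct.dualDistrib ℂ E F (α' ⊗ₜ β)) (TensorProduct.leftComm ℂ E E F s) =
      TensorProduct.dualDistrib ℂ E (E ⊗[ℂ] F)
        (α' ⊗ₜ TensorProduct.dualDistrib ℂ E F (α ⊗ₜ β)) s := by
    intro α α' β s
    induction s with
    | zero => simp
    | add s₁ s₂ h₁ h₂ => simp only [map_add, h₁, h₂]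
    | tmul a w =>
      induction w with
      | zero => simp
      | add s₁ s₂ h₁ h₂ => simp only [TensorProduct.tmul_add, map_add, h₁, h₂]
      | tmul b d => simp; ring
  have hsymm : ∀ s : E ⊗[ℂ] (E ⊗[ℂ] F),
      bracketTensor i' (bracketTensor i' j') (TensorProduct.leftComm ℂ E E F s) =
      bracketTensor i' (bracketTensor i' j') s := by
    intro s
    induction s with
    | zero => simp
    | add s₁ s₂ h₁ h₂ => simp only [map_add, h₁, h₂]
    | tmul a w =>
      induction w with
      | zero => simp
      | add s₁ s₂ h₁ h₂ => simp only [TensorProduct.tmul_add, map_add, h₁, h₂]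
      | tmul b d =>
        simp only [TensorProduct.leftComm_tmul, bracketTensor_tmul]
        rw [leibniz_lie, hcomm', zero_lie, zero_add]
  have hzero : t + TensorProduct.leftComm ℂ E E F t = 0 := by
    refine eq_zero_of_dualDistrib fun α γ => ?_
    obtain ⟨s, rfl⟩ := (TensorProduct.dualDistribEquiv ℂ E F).surjective γ
    change TensorProduct.dualDistrib ℂ E (E ⊗[ℂ] F)
      (α ⊗ₜ TensorProduct.dualDistrib ℂ E F s) _ = 0
    induction s with
    | zero => simp
    | add s₁ s₂ h₁ h₂ =>
      simp only [map_add, TensorProduct.tmul_add, LinearMap.add_apply] at h₁ h₂ ⊢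
      linear_combination h₁ + h₂
    | tmul α' β =>
      rw [map_add, hcoord]
      have h := hdiag (α + α') β
      simp only [TensorProduct.tmul_add, TensorProduct.add_tmul, map_add,
        LinearMap.add_apply] at h
      linear_combination h - hdiag α β - hdiag α' β
  have h := congrArg (bracketTensor i' (bracketTensor i' j')) hzero
  rw [map_add, hsymm, map_zero, ← two_smul ℂ, smul_eq_zero] at h
  exact h.resolve_left two_ne_zero

lemma bracketTensor_comm (i : E →ₗ[ℂ] L) (q : V →ₗ[ℂ] L) (t : E ⊗[ℂ] V) :
    bracketTensor q i (TensorProduct.comm ℂ E V t) = -bracketTensor i q t := by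
  induction t with
  | zero => simp
  | add s t hs ht => simp only [map_add, hs, ht, neg_add]
  | tmul x v => simp

lemma bracketTensor_mem (M : GLA L) {p r : ℤ} {i : E →ₗ[ℂ] L} {q : V →ₗ[ℂ] L}
    (hi : ∀ x, i x ∈ M.g p) (hq : ∀ v, q v ∈ M.g r) (t : E ⊗[ℂ] V) :
    bracketTensor i q t ∈ M.g (p + r) := by
  induction t with
  | zero => simp
  | add s t hs ht => rw [map_add]; exact Submodule.add_mem _ hs ht
  | tmul x v => rw [bracketTensor_tmul]; exact M.bracket_mem p r _ (hi x) _ (hq v)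

/-- The sum of all brackets of at most three elements of `E` and `F`, as a linear map. -/
noncomputable def nestedBracket (i : E →ₗ[ℂ] L) (j : F →ₗ[ℂ] L) :
    (E × F) × (E ⊗[ℂ] F) × (E ⊗[ℂ] (E ⊗[ℂ] F)) × (F ⊗[ℂ] (F ⊗[ℂ] E)) →ₗ[ℂ] L :=
  (i.coprod j).coprod ((bracketTensor i j).coprod
    ((bracketTensor i (bracketTensor i j)).coprod (bracketTensor j (bracketTensor j i))))

lemma nestedBracket_apply (i : E →ₗ[ℂ] L) (j : F →ₗ[ℂ] L) (x : E) (y : F) (t : E ⊗[ℂ] F)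
    (r : E ⊗[ℂ] (E ⊗[ℂ] F)) (s : F ⊗[ℂ] (F ⊗[ℂ] E)) :
    nestedBracket i j ((x, y), t, r, s) = i x + j y + (bracketTensor i j t +
      (bracketTensor i (bracketTensor i j) r + bracketTensor j (bracketTensor j i) s)) := rfl

lemma nestedBracket_of_pair (i : E →ₗ[ℂ] L) (j : F →ₗ[ℂ] L) (x : E) (y : F) :
    nestedBracket i j ((x, y), 0, 0, 0) = i x + j y := by
  simp [nestedBracket_apply]

lemma nestedBracket_lie (M : GLA L) (hk : ∀ p < -3, M.g p = ⊥) {i : E →ₗ[ℂ] L} {j : F →ₗ[ℂ] L}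
    (hi : ∀ x, i x ∈ M.g (-1)) (hj : ∀ y, j y ∈ M.g (-1)) (hii : ∀ x x', ⁅i x, i x'⁆ = 0)
    (hjj : ∀ y y', ⁅j y, j y'⁆ = 0) (x x' : E) (y y' : F) (t : E ⊗[ℂ] F)
    (r : E ⊗[ℂ] (E ⊗[ℂ] F)) (s : F ⊗[ℂ] (F ⊗[ℂ] E)) :
    nestedBracket i j ((0, 0), x ⊗ₜ y' - x' ⊗ₜ y, x ⊗ₜ t, -(y ⊗ₜ TensorProduct.comm ℂ E F t)) =
      ⁅i x + j y, nestedBracket i j ((x', y'), t, r, s)⁆ := by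
  have hr := bracketTensor_mem M hi (bracketTensor_mem M hi hj) r
  have hs := bracketTensor_mem M hj (bracketTensor_mem M hj hi) s
  have hzero : ∀ a ∈ M.g (-1), ∀ b ∈ M.g (-1 + (-1 + -1)), ⁅a, b⁆ = 0 := fun a ha b hb => by
    have h := M.bracket_mem _ _ a ha b hb
    rwa [hk _ (by norm_num), Submodule.mem_bot] at h
  simp only [nestedBracket_apply, map_sub, map_neg, map_zero, bracketTensor_tmul, lie_add, add_lie,
    bracketTensor_comm, lie_neg, neg_neg, hii, hjj, hzero _ (hi x) _ hr, hzero _ (hi x) _ hs,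
    hzero _ (hj y) _ hr, hzero _ (hj y) _ hs, ← lie_skew (i x') (j y)]
  abel

/-- The grading derivations separate the summands of `nestedBracket`. -/
lemma nestedBracket_eq_zero {ι : L →ₗ⁅ℂ⁆ LG} (hι : Function.Injective ι) {i : E →ₗ[ℂ] L}
    {j : F →ₗ[ℂ] L} (hact : ∀ A B, ∃ X, ActsThrough ι i X A ∧ ActsThrough ι j X B)
    {x : E} {y : F} {t : E ⊗[ℂ] F} {r : E ⊗[ℂ] (E ⊗[ℂ] F)} {s : F ⊗[ℂ] (F ⊗[ℂ] E)}
    (h : nestedBracket i j ((x, y), t, r, s) = 0) :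
    i x = 0 ∧ j y = 0 ∧ bracketTensor i j t = 0 ∧ bracketTensor i (bracketTensor i j) r = 0 ∧
      bracketTensor j (bracketTensor j i) s = 0 := by
  obtain ⟨X, hXi, hXj⟩ := hact LinearMap.id 0
  obtain ⟨Y, hYi, hYj⟩ := hact 0 LinearMap.id
  have hXx := hXi x
  have hXy := hXj y
  have hXt := hXi.bracketTensor hXj t
  have hXr := hXi.bracketTensor (hXi.bracketTensor hXj) r
  have hXs := hXj.bracketTensor (hXj.bracketTensor hXi) s
  have hYx := hYi x
  have hYy := hYj y
  have hYt := hYi.bracketTensor hYj t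
  have hYr := hYi.bracketTensor (hYi.bracketTensor hYj) r
  have hYs := hYj.bracketTensor (hYj.bracketTensor hYi) s
  simp only [LinearMap.lTensor_zero, LinearMap.rTensor_zero, add_zero, zero_add,
    LinearMap.lTensor_id, LinearMap.rTensor_id, LinearMap.add_apply, LinearMap.id_apply,
    LinearMap.zero_apply, map_add, map_zero]
    at hXx hXy hXt hXr hXs hYx hYy hYt hYr hYs
  have h₀ := congrArg ι h
  simp only [nestedBracket_apply, map_add, map_zero] at h₀
  simp only [← map_eq_zero_iff ι hι]
  generalize ι (i x) = a at *
  generalize ι (j y) = b at *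
  generalize ι (bracketTensor i j t) = c at *
  generalize ι (bracketTensor i (bracketTensor i j) r) = d at *
  generalize ι (bracketTensor j (bracketTensor j i) s) = k at *
  have hX := congrArg (⁅X, ·⁆) h₀
  have hY := congrArg (⁅Y, ·⁆) h₀
  simp only [lie_add, lie_zero, hXx, hXy, hXt, hXr, hXs, hYx, hYy, hYt, hYr, hYs] at hX hY
  have h₁ : c + (2 : ℂ) • d + (2 : ℂ) • k = 0 := by
    linear_combination (norm := module) hX + hY - h₀
  have h₁X := congrArg (⁅X, ·⁆) h₁
  have h₁Y := congrArg (⁅Y, ·⁆) h₁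
  simp only [lie_add, lie_smul, lie_zero, hXt, hXr, hXs, hYt, hYr, hYs] at h₁X h₁Y
  have hd : d = 0 := by linear_combination (norm := module) (1 / 2 : ℂ) • (h₁X - h₁)
  have hs : k = 0 := by linear_combination (norm := module) (1 / 2 : ℂ) • (h₁Y - h₁)
  subst hd hs
  have hc : c = 0 := by simpa using h₁
  subst hc
  exact ⟨by simpa using hX, by simpa using hY, rfl, rfl, rfl⟩

end BracketTensor

section Generation

variable {L L' : Type} [LieRing L] [LieAlgebra ℂ L] [LieRing L'] [LieAlgebra ℂ L']

lemma graded_induction {P : ℤ → Prop}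
    (nonneg : ∀ p, 0 ≤ p → P p) (neg_one : P (-1)) (step : ∀ p < 0, P p → P (p - 1)) (p : ℤ) :
    P p := by
  rcases le_or_gt 0 p with h | h
  · exact nonneg p h
  · exact Int.leInductionDown neg_one (fun q hq => step q (by lia)) p (by lia)

lemma GLA.IsFGLA.eq_top {M : GLA L} (hM : M.IsFGLA) (N : Submodule ℂ L) (h₁ : M.g (-1) ≤ N)
    (h : ∀ x ∈ M.g (-1), ∀ y ∈ N, ⁅x, y⁆ ∈ N) : N = ⊤ := by
  rw [eq_top_iff, ← M.internal.submodule_iSup_eq_top]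
  refine iSup_le fun p => ?_
  refine graded_induction (P := fun p => M.g p ≤ N) (fun p hp => ?_) h₁ (fun p hp ih => ?_) p
  · simp [hM.nonneg p hp]
  · rw [hM.generated p hp, Submodule.span_le]
    rintro _ ⟨x, hx, y, hy, rfl⟩
    rw [← lie_skew]
    exact N.neg_mem (h y hy x (ih hx))

lemma GLA.IsFGLA.map_mem {M : GLA L} (hM : M.IsFGLA) {M' : GLA L'} (Φ : L →ₗ⁅ℂ⁆ L')
    (h : ∀ x ∈ M.g (-1), Φ x ∈ M'.g (-1)) (p : ℤ) : ∀ x ∈ M.g p, Φ x ∈ M'.g p := by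
  refine graded_induction (P := fun p => ∀ x ∈ M.g p, Φ x ∈ M'.g p)
    (fun p hp x hx => ?_) h (fun p hp ih => ?_) p
  · rw [hM.nonneg p hp, Submodule.mem_bot] at hx
    simp [hx]
  · change M.g (p - 1) ≤ (M'.g (p - 1)).comap Φ.toLinearMap
    rw [hM.generated p hp, Submodule.span_le]
    rintro _ ⟨x, hx, y, hy, rfl⟩
    change Φ ⁅x, y⁆ ∈ M'.g (p - 1)
    rw [LieHom.map_lie]
    exact M'.bracket_mem p (-1) _ (ih x hx) _ (h y hy)

lemma GLA.IsFGLA.hom_ext {M : GLA L} (hM : M.IsFGLA) {Φ Ψ : L →ₗ⁅ℂ⁆ L'}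
    (h : ∀ x ∈ M.g (-1), Φ x = Ψ x) : Φ = Ψ := by
  have htop := hM.eq_top (LinearMap.eqLocus Φ.toLinearMap Ψ.toLinearMap) h fun x hx y hy => by
    change Φ ⁅x, y⁆ = Ψ ⁅x, y⁆
    have hy' : Φ y = Ψ y := hy
    rw [LieHom.map_lie, LieHom.map_lie, h x hx, hy']
  ext x
  exact (htop ▸ Submodule.mem_top : x ∈ LinearMap.eqLocus Φ.toLinearMap Ψ.toLinearMap)

lemma GLA.IsFGLA.surjective {M' : GLA L'} (hM' : M'.IsFGLA) (Φ : L →ₗ⁅ℂ⁆ L')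
    (h : ∀ y ∈ M'.g (-1), ∃ x, Φ x = y) : Function.Surjective Φ := by
  have htop := hM'.eq_top (LinearMap.range Φ.toLinearMap) h fun x hx y hy => by
    obtain ⟨a, rfl⟩ := h x hx
    obtain ⟨b, rfl⟩ := hy
    exact ⟨⁅a, b⁆, Φ.map_lie a b⟩
  exact LinearMap.range_eq_top.mp htop

/-- A presentation `P : W → L` of an FGLA as a vector space, on which the brackets with `g₋₁` lift
compatibly with a second map `P' : W → L'`, induces a Lie algebra morphism `L → L'` as soon as
`ker P ≤ ker P'`. -/
lemma GLA.IsFGLA.exists_hom {M : GLA L} (hM : M.IsFGLA) {W : Type} [AddCommGroup W] [Module ℂ W]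
    (P : W →ₗ[ℂ] L) (P' : W →ₗ[ℂ] L') (hker : ∀ w, P w = 0 → P' w = 0)
    (hlie : ∀ x ∈ M.g (-1), ∃ a, P a = x ∧
      ∀ w, ∃ w', P w' = ⁅P a, P w⁆ ∧ P' w' = ⁅P' a, P' w⁆) :
    ∃ Φ : L →ₗ⁅ℂ⁆ L', ∀ w, Φ (P w) = P' w := by
  have hsurj : LinearMap.range P = ⊤ := by
    refine hM.eq_top _ (fun x hx => (hlie x hx).imp fun a ha => ha.1) ?_
    rintro x hx _ ⟨w, rfl⟩
    obtain ⟨a, rfl, ha⟩ := hlie x hx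
    obtain ⟨w', hw', -⟩ := ha w
    exact ⟨w', hw'⟩
  obtain ⟨s, hs⟩ := P.exists_rightInverse_of_surjective hsurj
  set Φ := P' ∘ₗ s
  have hΦ : ∀ w, Φ (P w) = P' w := fun w => by
    have h := hker (s (P w) - w) (by
      rw [map_sub, sub_eq_zero]
      exact LinearMap.congr_fun hs (P w))
    rwa [map_sub, sub_eq_zero] at h
  let N : Submodule ℂ L :=
    { carrier := {x | ∀ y, Φ ⁅x, y⁆ = ⁅Φ x, Φ y⁆}
      add_mem' := fun {x x'} hx hx' y => by
        rw [add_lie, map_add, hx y, hx' y, map_add, add_lie]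
      zero_mem' := fun y => by simp
      smul_mem' := fun r x hx y => by rw [smul_lie, map_smul, hx y, map_smul, smul_lie] }
  have hN₁ : M.g (-1) ≤ N := by
    intro x hx y
    obtain ⟨a, rfl, ha⟩ := hlie x hx
    obtain ⟨w, rfl⟩ : y ∈ LinearMap.range P := hsurj ▸ Submodule.mem_top
    obtain ⟨w', h₁, h₂⟩ := ha w
    rw [← h₁, hΦ, hΦ, hΦ, h₂]
  have hN : N = ⊤ := hM.eq_top N hN₁ fun x hx z hz y => by
    have hx' := hN₁ hx
    rw [lie_lie, map_sub, hx' _, hz, hz, hx' _, hx' _, lie_lie]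
  exact ⟨{ Φ with map_lie' := fun {x y} => (hN ▸ Submodule.mem_top : x ∈ N) y }, hΦ⟩

end Generation

section PseudoProduct

variable {L L' : Type} [LieRing L] [LieAlgebra ℂ L] [LieRing L'] [LieAlgebra ℂ L']
  {M : GLA L} {M' : GLA L'} {e f : Submodule ℂ L} {e' f' : Submodule ℂ L'}

lemma IsPPFGLA.swap (h : IsPPFGLA M e f) : IsPPFGLA M f e :=
  ⟨h.fgla, h.f_ne_bot, h.e_ne_bot, by rw [sup_comm, h.sup_eq], by rw [inf_comm, h.inf_eq],
    h.lie_ff, h.lie_ee⟩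

lemma IsFreePPFGLA.swap {m n μ : ℕ} (h : IsFreePPFGLA M e f m n μ) :
    IsFreePPFGLA M f e n m μ :=
  ⟨h.1.swap, h.2.1, h.2.2.2.1, h.2.2.1, fun L' _ _ M' e' f' hpp hk φ hφ he hf =>
    h.2.2.2.2 L' M' f' e' hpp.swap hk φ hφ hf he⟩

lemma IsPPFGLA.e_le (h : IsPPFGLA M e f) : e ≤ M.g (-1) := h.sup_eq ▸ le_sup_left

lemma IsPPFGLA.f_le (h : IsPPFGLA M e f) : f ≤ M.g (-1) := h.sup_eq ▸ le_sup_right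

lemma IsPPFGLA.neg_two_eq (h : IsPPFGLA M e f) :
    M.g (-2) = Submodule.span ℂ {z : L | ∃ x ∈ e, ∃ y ∈ f, z = ⁅x, y⁆} := by
  rw [show (-2 : ℤ) = -1 - 1 by norm_num, h.fgla.generated (-1) (by norm_num)]
  refine le_antisymm (Submodule.span_le.mpr ?_) (Submodule.span_mono ?_)
  · rintro _ ⟨a, ha, b, hb, rfl⟩
    rw [← h.sup_eq] at ha hb
    obtain ⟨u, hu, v, hv, rfl⟩ := Submodule.mem_sup.mp ha
    obtain ⟨u', hu', v', hv', rfl⟩ := Submodule.mem_sup.mp hb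
    have hab : ⁅u + v, u' + v'⁆ = ⁅u, v'⁆ - ⁅u', v⁆ := by
      rw [add_lie, lie_add, lie_add, h.lie_ee u hu u' hu', h.lie_ff v hv v' hv', ← lie_skew v u']
      abel
    rw [hab]
    exact Submodule.sub_mem _ (Submodule.subset_span ⟨u, hu, v', hv', rfl⟩)
      (Submodule.subset_span ⟨u', hu', v, hv, rfl⟩)
  · rintro _ ⟨x, hx, y, hy, rfl⟩
    exact ⟨x, h.e_le hx, y, h.f_le hy, rfl⟩

lemma IsPPFGLA.exists_lie_ne_zero (h : IsPPFGLA M e f) {μ : ℕ} (hμ : 2 ≤ μ)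
    (hk : M.IsOfKind μ) : ∃ (x : e) (y : f), ⁅(x : L), (y : L)⁆ ≠ 0 := by
  by_contra! h0
  have h2 : M.g (-2) = ⊥ := by
    rw [h.neg_two_eq, Submodule.span_eq_bot]
    rintro _ ⟨x, hx, y, hy, rfl⟩
    exact h0 ⟨x, hx⟩ ⟨y, hy⟩
  refine hk.1 (Int.leInductionDown (motive := fun p _ => M.g p = ⊥) h2 (fun p hp ih => ?_)
    (-(μ : ℤ)) (by lia))
  rw [h.fgla.generated p (by lia), Submodule.span_eq_bot]
  rintro _ ⟨x, hx, y, -, rfl⟩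
  rw [ih, Submodule.mem_bot] at hx
  rw [hx, zero_lie]

lemma IsPPFGLA.exists_lie_lie_ne_zero (h : IsPPFGLA M e f)
    (hc : ∀ x ∈ M.g (-1), (∀ z ∈ M.g (-2), ⁅x, z⁆ = 0) → x = 0) :
    ∃ (x x' : e) (y : f), ⁅(x : L), ⁅(x' : L), (y : L)⁆⁆ ≠ 0 := by
  by_contra! h0
  obtain ⟨u, hu, hne⟩ := Submodule.exists_mem_ne_zero_of_ne_bot h.e_ne_bot
  refine hne (hc u (h.e_le hu) fun z hz => ?_)
  rw [h.neg_two_eq] at hz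
  induction hz using Submodule.span_induction with
  | mem z hz =>
    obtain ⟨x, hx, y, hy, rfl⟩ := hz
    exact h0 ⟨u, hu⟩ ⟨x, hx⟩ ⟨y, hy⟩
  | zero => exact lie_zero u
  | add a b _ _ ha hb => rw [lie_add, ha, hb, add_zero]
  | smul r a _ ha => rw [lie_smul, ha, smul_zero]

lemma IsPPFGLA.exists_hom {LG : Type} [LieRing LG] [LieAlgebra ℂ LG] (h : IsPPFGLA M e f)
    (hk : ∀ p < -3, M.g p = ⊥) (h' : IsPPFGLA M' e' f') (hk' : ∀ p < -3, M'.g p = ⊥)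
    {ι : L →ₗ⁅ℂ⁆ LG} (hι : Function.Injective ι)
    (hact : ∀ A B, ∃ X, ActsThrough ι e.subtype X A ∧ ActsThrough ι f.subtype X B)
    (hne : ∃ (x : e) (y : f), ⁅(x : L), (y : L)⁆ ≠ 0) (i' : e →ₗ[ℂ] L') (j' : f →ₗ[ℂ] L')
    (hi' : ∀ x, i' x ∈ e') (hj' : ∀ y, j' y ∈ f')
    (hef : ∀ t, bracketTensor e.subtype (bracketTensor e.subtype f.subtype) t = 0 →
      bracketTensor i' (bracketTensor i' j') t = 0)
    (hfe : ∀ t, bracketTensor f.subtype (bracketTensor f.subtype e.subtype) t = 0 →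
      bracketTensor j' (bracketTensor j' i') t = 0) :
    ∃ Φ : L →ₗ⁅ℂ⁆ L', (∀ x : e, Φ x = i' x) ∧ ∀ y : f, Φ y = j' y := by
  have := h.fgla.fd
  have hker : ∀ w, nestedBracket e.subtype f.subtype w = 0 → nestedBracket i' j' w = 0 := by
    rintro ⟨⟨x, y⟩, t, r, s⟩ hw
    obtain ⟨hx, hy, ht, hr, hs⟩ := nestedBracket_eq_zero hι hact hw
    rw [nestedBracket_apply, hef r hr, hfe s hs, (Submodule.coe_eq_zero.mp hx : x = 0),
      (Submodule.coe_eq_zero.mp hy : y = 0), eq_zero_of_bracketTensor_eq_zero hι hact hne ht]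
    simp
  have hlie : ∀ z ∈ M.g (-1), ∃ a, nestedBracket e.subtype f.subtype a = z ∧
      ∀ w, ∃ w', nestedBracket e.subtype f.subtype w' =
          ⁅nestedBracket e.subtype f.subtype a, nestedBracket e.subtype f.subtype w⁆ ∧
        nestedBracket i' j' w' = ⁅nestedBracket i' j' a, nestedBracket i' j' w⁆ := by
    intro z hz
    rw [← h.sup_eq] at hz
    obtain ⟨x, hx, y, hy, rfl⟩ := Submodule.mem_sup.mp hz
    have hP := nestedBracket_lie M hk (i := e.subtype) (j := f.subtype) (fun x => h.e_le x.2)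
      (fun y => h.f_le y.2) (fun x x' => h.lie_ee _ x.2 _ x'.2) (fun y y' => h.lie_ff _ y.2 _ y'.2)
    have hP' := nestedBracket_lie M' hk' (fun x => h'.e_le (hi' x)) (fun y => h'.f_le (hj' y))
      (fun x x' => h'.lie_ee _ (hi' x) _ (hi' x')) (fun y y' => h'.lie_ff _ (hj' y) _ (hj' y'))
    refine ⟨((⟨x, hx⟩, ⟨y, hy⟩), 0, 0, 0), nestedBracket_of_pair _ _ _ _, ?_⟩
    rintro ⟨⟨x', y'⟩, t, r, s⟩
    refine ⟨_, (hP ⟨x, hx⟩ x' ⟨y, hy⟩ y' t r s).trans ?_,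
      (hP' ⟨x, hx⟩ x' ⟨y, hy⟩ y' t r s).trans ?_⟩
    · rw [nestedBracket_of_pair]
    · rw [nestedBracket_of_pair]
  obtain ⟨Φ, hΦ⟩ := h.fgla.exists_hom _ _ hker hlie
  exact ⟨Φ, fun x => by simpa [nestedBracket_of_pair] using hΦ ((x, 0), 0, 0, 0),
    fun y => by simpa [nestedBracket_of_pair] using hΦ ((0, y), 0, 0, 0)⟩

lemma IsPPFGLA.isFree {LG : Type} [LieRing LG] [LieAlgebra ℂ LG] (h : IsPPFGLA M e f) {μ : ℕ}
    (hμ : 2 ≤ μ) (hk : M.IsOfKind μ) (hμ3 : μ ≤ 3) {ι : L →ₗ⁅ℂ⁆ LG} (hι : Function.Injective ι)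
    (hact : ∀ A B, ∃ X, ActsThrough ι e.subtype X A ∧ ActsThrough ι f.subtype X B)
    (hcent : μ = 3 → ∀ x ∈ M.g (-1), (∀ z ∈ M.g (-2), ⁅x, z⁆ = 0) → x = 0) :
    IsFreePPFGLA M e f (Module.finrank ℂ e) (Module.finrank ℂ f) μ := by
  refine ⟨h, hk, rfl, rfl, fun L' _ _ M' e' f' h' hk' φ hφ he hf => ?_⟩
  have := h.fgla.fd
  have hext : ∃ Φ : L →ₗ⁅ℂ⁆ L', ∀ x : M.g (-1), Φ (x : L) = (φ x : L') := by
    set i' : e →ₗ[ℂ] L' := (M'.g (-1)).subtype ∘ₗ φ ∘ₗ Submodule.inclusion h.e_le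
    set j' : f →ₗ[ℂ] L' := (M'.g (-1)).subtype ∘ₗ φ ∘ₗ Submodule.inclusion h.f_le
    have hi' : ∀ x, i' x ∈ e' := fun x => he _ (h.e_le x.2) x.2
    have hj' : ∀ y, j' y ∈ f' := fun y => hf _ (h.f_le y.2) y.2
    have hi'₁ : ∀ x, i' x ∈ M'.g (-1) := fun x => h'.e_le (hi' x)
    have hj'₁ : ∀ y, j' y ∈ M'.g (-1) := fun y => h'.f_le (hj' y)
    obtain ⟨Φ, hΦe, hΦf⟩ := h.exists_hom (fun p hp => hk.2 p (by lia)) h'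
      (fun p hp => hk'.2 p (by lia)) hι hact (h.exists_lie_ne_zero hμ hk) i' j' hi' hj'
      (fun t ht => by
        rcases hμ3.lt_or_eq with hlt | heq
        · have hmem := bracketTensor_mem M' hi'₁ (bracketTensor_mem M' hi'₁ hj'₁) t
          rwa [hk'.2 _ (by lia), Submodule.mem_bot] at hmem
        · exact bracketTensor_bracketTensor_eq_zero hι hact
            (fun x x' => h.lie_ee _ x.2 _ x'.2) (h.exists_lie_lie_ne_zero (hcent heq))
            (fun x x' => h'.lie_ee _ (hi' x) _ (hi' x')) ht)
      (fun t ht => by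
        rcases hμ3.lt_or_eq with hlt | heq
        · have hmem := bracketTensor_mem M' hj'₁ (bracketTensor_mem M' hj'₁ hi'₁) t
          rwa [hk'.2 _ (by lia), Submodule.mem_bot] at hmem
        · exact bracketTensor_bracketTensor_eq_zero hι
            (fun A B => (hact B A).imp fun X hX => hX.symm)
            (fun y y' => h.lie_ff _ y.2 _ y'.2) (h.swap.exists_lie_lie_ne_zero (hcent heq))
            (fun y y' => h'.lie_ff _ (hj' y) _ (hj' y')) ht)
    refine ⟨Φ, ?_⟩
    rintro ⟨z, hz⟩
    obtain ⟨x, hx, y, hy, rfl⟩ := Submodule.mem_sup.mp (h.sup_eq.symm ▸ hz : z ∈ e ⊔ f)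
    calc Φ (x + y) = φ ⟨x, h.e_le hx⟩ + φ ⟨y, h.f_le hy⟩ := by
          rw [map_add]
          exact congrArg₂ (· + ·) (hΦe ⟨x, hx⟩) (hΦf ⟨y, hy⟩)
      _ = φ ⟨x + y, hz⟩ := by
          rw [← Submodule.coe_add, ← map_add]
          rfl
  obtain ⟨Φ, hΦ⟩ := hext
  refine ⟨Φ, ⟨h.fgla.map_mem Φ fun x hx => ?_, h'.fgla.surjective Φ fun y hy => ?_, hΦ⟩,
    fun Ψ hΨ => h.fgla.hom_ext fun x hx => (hΨ.2.2 ⟨x, hx⟩).trans (hΦ ⟨x, hx⟩).symm⟩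
  · exact hΦ ⟨x, hx⟩ ▸ (φ ⟨x, hx⟩).2
  · obtain ⟨x, hx⟩ := hφ ⟨y, hy⟩
    exact ⟨x, by rw [hΦ x, hx]⟩

end PseudoProduct

section Filiform

/-- The semidirect product `ℂ ⋉ V` in which the generator of `ℂ` acts on the abelian ideal `V`
by `N`. -/
def LineExtension {V : Type} [AddCommGroup V] [Module ℂ V] (_N : Module.End ℂ V) : Type := ℂ × V

namespace LineExtension

variable {V : Type} [AddCommGroup V] [Module ℂ V] {N : Module.End ℂ V}

instance : AddCommGroup (LineExtension N) := inferInstanceAs (AddCommGroup (ℂ × V))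

instance : Module ℂ (LineExtension N) := inferInstanceAs (Module ℂ (ℂ × V))

instance [FiniteDimensional ℂ V] : FiniteDimensional ℂ (LineExtension N) :=
  inferInstanceAs (FiniteDimensional ℂ (ℂ × V))

/-- The element of the semidirect product with the given components. -/
def mk (a : ℂ) (v : V) : LineExtension N := (a, v)

/-- The component in `ℂ`. -/
def fst : LineExtension N →ₗ[ℂ] ℂ := LinearMap.fst ℂ ℂ V

/-- The component in `V`. -/
def snd : LineExtension N →ₗ[ℂ] V := LinearMap.snd ℂ ℂ V

@[simp] lemma fst_mk (a : ℂ) (v : V) : fst (mk a v : LineExtension N) = a := rfl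

@[simp] lemma snd_mk (a : ℂ) (v : V) : snd (mk a v : LineExtension N) = v := rfl

@[ext]
lemma ext {x y : LineExtension N} (h₁ : fst x = fst y) (h₂ : snd x = snd y) : x = y :=
  Prod.ext h₁ h₂

instance : Bracket (LineExtension N) (LineExtension N) :=
  ⟨fun x y => mk 0 (fst x • N (snd y) - fst y • N (snd x))⟩

lemma lie_def (x y : LineExtension N) :
    ⁅x, y⁆ = mk 0 (fst x • N (snd y) - fst y • N (snd x)) := rfl

instance : LieRing (LineExtension N) where
  add_lie x y z := by
    ext1
    · simp [lie_def]
    · simp only [lie_def, map_add, snd_mk]; module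
  lie_add x y z := by
    ext1
    · simp [lie_def]
    · simp only [lie_def, map_add, snd_mk]; module
  lie_self x := by ext1 <;> simp [lie_def]
  leibniz_lie x y z := by
    ext1
    · simp [lie_def]
    · simp only [lie_def, map_add, map_sub, map_smul, fst_mk, snd_mk]; module

instance : LieAlgebra ℂ (LineExtension N) where
  lie_smul r x y := by
    ext1
    · simp [lie_def]
    · simp only [lie_def, map_smul, snd_mk, smul_eq_mul]; module

end LineExtension

/-- The nilpotent shift `δ_k ↦ δ_{k+1}` on `ℂ^μ`. -/
def shift (μ : ℕ) : Module.End ℂ (Fin μ → ℂ) where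
  toFun q k := if k.1 = 0 then 0 else q ⟨k.1 - 1, by lia⟩
  map_add' p q := by ext k; by_cases h : k.1 = 0 <;> simp [h]
  map_smul' r q := by ext k; by_cases h : k.1 = 0 <;> simp [h]

lemma shift_apply {μ : ℕ} (q : Fin μ → ℂ) (k : Fin μ) :
    shift μ q k = if k.1 = 0 then 0 else q ⟨k.1 - 1, by lia⟩ := rfl

lemma shift_single {μ : ℕ} (k : ℕ) (hk : k + 1 < μ) :
    shift μ (Pi.single ⟨k, by lia⟩ 1) = Pi.single ⟨k + 1, hk⟩ 1 := by
  ext l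
  simp only [shift_apply, Pi.single_apply, Fin.ext_iff]
  split_ifs <;> first | rfl | lia

/-- The filiform Lie algebra of dimension `μ + 1`. -/
abbrev Filiform (μ : ℕ) : Type := LineExtension (shift μ)

namespace Filiform

open LineExtension

variable {μ : ℕ}

/-- The degree operator. -/
def degree (μ : ℕ) : Module.End ℂ (Filiform μ) where
  toFun x := mk (-fst x) (fun k => -((k.1 : ℂ) + 1) * snd x k)
  map_add' x y := by
    ext1
    · simp only [map_add, fst_mk]; ring
    · ext k; simp only [map_add, snd_mk, Pi.add_apply]; ring
  map_smul' r x := by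
    ext1
    · simp
    · ext k; simp only [map_smul, snd_mk, Pi.smul_apply, smul_eq_mul, RingHom.id_apply]; ring

lemma mem_eigenspace {c : ℂ} {x : Filiform μ} : x ∈ (degree μ).eigenspace c ↔
    -fst x = c * fst x ∧ ∀ k, -((k.1 : ℂ) + 1) * snd x k = c * snd x k := by
  rw [Module.End.mem_eigenspace_iff, LineExtension.ext_iff, funext_iff]
  rfl

lemma degree_lie (x y : Filiform μ) : degree μ ⁅x, y⁆ = ⁅degree μ x, y⁆ + ⁅x, degree μ y⁆ := by
  ext1
  · simp [degree, lie_def]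
  · ext k
    simp only [degree, LinearMap.coe_mk, AddHom.coe_mk, lie_def, map_add, fst_mk, snd_mk,
      Pi.add_apply, Pi.sub_apply, Pi.smul_apply, smul_eq_mul, shift_apply]
    split_ifs with h
    · ring
    · have : ((k.1 - 1 : ℕ) : ℂ) = k.1 - 1 := by
        rw [Nat.cast_sub (by lia)]; simp
      rw [this]; ring

/-- The element of degree `-1` acting on the others by the shift. -/
def X (μ : ℕ) : Filiform μ := mk 1 0

/-- The element of degree `-(k + 1)` of the abelian ideal. -/
def Y (k : Fin μ) : Filiform μ := mk 0 (Pi.single k 1)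

lemma eq_sum (x : Filiform μ) : x = fst x • X μ + ∑ k, snd x k • Y k := by
  ext1
  · simp [X, Y]
  · ext l
    simp [X, Y, Finset.sum_apply, Pi.single_apply]

lemma lie_X_Y {k : ℕ} (hk : k + 1 < μ) : ⁅X μ, Y ⟨k, by lia⟩⁆ = Y ⟨k + 1, hk⟩ := by
  simp [lie_def, X, Y, shift_single k hk]

lemma X_mem : X μ ∈ (degree μ).eigenspace ((-1 : ℤ) : ℂ) := by
  rw [mem_eigenspace]
  simp [X]

lemma Y_mem (k : Fin μ) : Y k ∈ (degree μ).eigenspace ((-((k.1 : ℤ) + 1) : ℤ) : ℂ) := by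
  simp only [mem_eigenspace, Y, fst_mk, snd_mk, Pi.single_apply]
  refine ⟨by simp, fun l => ?_⟩
  split_ifs with h
  · subst h; push_cast; ring
  · simp

/-- The grading of the filiform Lie algebra. -/
def gla (μ : ℕ) : GLA (Filiform μ) where
  g p := (degree μ).eigenspace (p : ℂ)
  internal := by
    refine DirectSum.isInternal_submodule_of_iSupIndep_of_iSup_eq_top
      ((degree μ).eigenspaces_iSupIndep.comp Int.cast_injective) (eq_top_iff.mpr fun x _ => ?_)
    rw [eq_sum x]
    refine Submodule.add_mem _ (Submodule.smul_mem _ _ (Submodule.mem_iSup_of_mem (-1) X_mem))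
      (Submodule.sum_mem _ fun k _ => Submodule.smul_mem _ _ (Submodule.mem_iSup_of_mem _ (Y_mem k)))
  bracket_mem p q x hx y hy := by
    rw [Module.End.mem_eigenspace_iff] at *
    rw [degree_lie, hx, hy, smul_lie, lie_smul, ← add_smul]
    push_cast
    rfl
  findim p := inferInstance

lemma mem_gla {p : ℤ} {x : Filiform μ} : x ∈ (gla μ).g p ↔
    (p ≠ -1 → fst x = 0) ∧ ∀ k : Fin μ, p ≠ -((k.1 : ℤ) + 1) → snd x k = 0 := by
  have key : ∀ (n : ℤ) (z : ℂ), (n : ℂ) * z = p * z ↔ (p ≠ n → z = 0) := fun n z => by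
    rw [mul_eq_mul_right_iff, Int.cast_inj]
    grind
  refine mem_eigenspace.trans (and_congr ?_ (forall_congr' fun k => ?_))
  · rw [← key]; simp
  · rw [← key]; simp

lemma X_mem_gla : X μ ∈ (gla μ).g (-1) := X_mem

lemma Y_mem_gla {p : ℤ} (k : Fin μ) (hp : p = -((k.1 : ℤ) + 1)) : Y k ∈ (gla μ).g p :=
  hp ▸ Y_mem k

lemma gla_eq_bot {p : ℤ} (h₁ : p ≠ -1) (h₂ : ∀ k : Fin μ, p ≠ -((k.1 : ℤ) + 1)) :
    (gla μ).g p = ⊥ := by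
  rw [eq_bot_iff]
  intro x hx
  rw [mem_gla] at hx
  rw [Submodule.mem_bot]
  ext1
  · rw [hx.1 h₁, map_zero]
  · ext k
    rw [hx.2 k (h₂ k)]
    simp

lemma isFGLA : (gla μ).IsFGLA where
  fd := inferInstance
  nonneg p hp := gla_eq_bot (by lia) (by lia)
  neg_one_ne_bot h := by
    have hX : X μ ∈ (gla μ).g (-1) := X_mem_gla
    rw [h, Submodule.mem_bot] at hX
    simpa [X] using congrArg fst hX
  generated p hp := by
    refine le_antisymm (fun x hx => ?_) (Submodule.span_le.mpr ?_)
    · obtain ⟨h₁, h₂⟩ := mem_gla.mp hx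
      rw [eq_sum x, h₁ (by lia), zero_smul, zero_add]
      refine Submodule.sum_mem _ fun k _ => ?_
      by_cases hk : p - 1 = -((k.1 : ℤ) + 1)
      · obtain ⟨k, hkμ⟩ := k
        obtain ⟨l, rfl⟩ : ∃ l, k = l + 1 := ⟨k - 1, by lia⟩
        refine Submodule.smul_mem _ _ ?_
        rw [← lie_X_Y hkμ, ← lie_skew]
        refine Submodule.neg_mem _ (Submodule.subset_span
          ⟨Y ⟨l, by lia⟩, Y_mem_gla _ ?_, X μ, X_mem_gla, rfl⟩)
        push_cast at hk
        lia
      · rw [h₂ k hk, zero_smul]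
        exact Submodule.zero_mem _
    · rintro _ ⟨x, hx, y, hy, rfl⟩
      exact (gla μ).bracket_mem p (-1) x hx y hy

lemma isOfKind (hμ : 0 < μ) : (gla μ).IsOfKind μ := by
  refine ⟨fun h => ?_, fun p hp => gla_eq_bot (by lia) (fun k => by have := k.2; lia)⟩
  have hY : Y (⟨μ - 1, by lia⟩ : Fin μ) ∈ (gla μ).g (-(μ : ℤ)) := Y_mem_gla _ (by simp; lia)
  rw [h, Submodule.mem_bot] at hY
  simpa [Y] using congrArg snd hY

lemma isPPFGLA (hμ : 0 < μ) :
    IsPPFGLA (gla μ) (Submodule.span ℂ {X μ}) (Submodule.span ℂ {Y ⟨0, hμ⟩}) where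
  fgla := isFGLA
  e_ne_bot h := by
    rw [Submodule.span_singleton_eq_bot] at h
    simpa [X] using congrArg fst h
  f_ne_bot h := by
    rw [Submodule.span_singleton_eq_bot] at h
    simpa [Y] using congrArg snd h
  sup_eq := by
    refine le_antisymm (sup_le ?_ ?_) fun x hx => ?_
    · rw [Submodule.span_singleton_le_iff_mem]
      exact X_mem_gla
    · rw [Submodule.span_singleton_le_iff_mem]
      exact Y_mem_gla _ (by simp)
    · rw [eq_sum x, Finset.sum_eq_single_of_mem ⟨0, hμ⟩ (Finset.mem_univ _)]
      · exact Submodule.add_mem_sup (Submodule.smul_mem _ _ (Submodule.mem_span_singleton_self _))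
          (Submodule.smul_mem _ _ (Submodule.mem_span_singleton_self _))
      · intro k _ hk
        rw [(mem_gla.mp hx).2 k (fun h => hk (Fin.ext (by simp; lia))), zero_smul]
  inf_eq := by
    rw [eq_bot_iff]
    rintro x ⟨hx, hy⟩
    obtain ⟨a, rfl⟩ := Submodule.mem_span_singleton.mp hx
    obtain ⟨b, hb⟩ := Submodule.mem_span_singleton.mp hy
    have h := congrArg fst hb
    simp only [X, Y, map_smul, fst_mk, smul_eq_mul, mul_zero, mul_one] at h
    simp [← h]
  lie_ee x hx y hy := by
    obtain ⟨a, rfl⟩ := Submodule.mem_span_singleton.mp hx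
    obtain ⟨b, rfl⟩ := Submodule.mem_span_singleton.mp hy
    simp
  lie_ff x hx y hy := by
    obtain ⟨a, rfl⟩ := Submodule.mem_span_singleton.mp hx
    obtain ⟨b, rfl⟩ := Submodule.mem_span_singleton.mp hy
    simp

lemma lie_lie_ne_zero (hμ : 3 ≤ μ) (b : ℂ) :
    ⁅X μ + b • Y (⟨0, by lia⟩ : Fin μ), ⁅X μ, Y (⟨0, by lia⟩ : Fin μ)⁆⁆ ≠ 0 := by
  rw [lie_X_Y (k := 0) (by lia), add_lie, lie_X_Y (k := 0 + 1) (by lia), smul_lie]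
  intro h
  have h2 : 2 < μ := hμ
  have h' := congrFun (congrArg snd h) ⟨2, h2⟩
  simp [lie_def, Y] at h'

end Filiform

end Filiform

section NotFree

lemma Submodule.exists_dual_eq_one {L : Type} [AddCommGroup L] [Module ℂ L] {e f : Submodule ℂ L}
    (h : e ⊓ f = ⊥) {x : L} (hx : x ∈ e) (hne : x ≠ 0) :
    ∃ α : Module.Dual ℂ L, α x = 1 ∧ ∀ y ∈ f, α y = 0 := by
  have hxf : x ∉ f := fun hxf => hne (by simpa [h] using Submodule.mem_inf.mpr ⟨hx, hxf⟩)
  obtain ⟨α, hα, hf⟩ := Submodule.exists_le_ker_of_notMem hxf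
  exact ⟨(α x)⁻¹ • α, by simp [hα], fun y hy => by
    simp [LinearMap.mem_ker.mp (hf hy)]⟩

lemma IsFreePPFGLA.eq_zero_of_centralizes {L : Type} [LieRing L] [LieAlgebra ℂ L] {M : GLA L}
    {e f : Submodule ℂ L} {m n μ : ℕ} (h : IsFreePPFGLA M e f m n μ) (hμ : 3 ≤ μ) {u v : L}
    (hu : u ∈ e) (hv : v ∈ f) (hc : ∀ z ∈ M.g (-2), ⁅u + v, z⁆ = 0) : u = 0 := by
  by_contra hne
  obtain ⟨hpp, -, -, -, hfree⟩ := h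
  obtain ⟨w, hw, hwne⟩ := Submodule.exists_mem_ne_zero_of_ne_bot hpp.f_ne_bot
  obtain ⟨α, hαu, hαf⟩ := Submodule.exists_dual_eq_one hpp.inf_eq hu hne
  obtain ⟨β, hβw, hβe⟩ := Submodule.exists_dual_eq_one hpp.swap.inf_eq hw hwne
  have hμ0 : 0 < μ := by lia
  have hF := Filiform.isPPFGLA hμ0
  set x := Filiform.X μ
  set y := Filiform.Y (⟨0, hμ0⟩ : Fin μ)
  have hx : x ∈ (Filiform.gla μ).g (-1) := Filiform.X_mem_gla
  have hy : y ∈ (Filiform.gla μ).g (-1) := Filiform.Y_mem_gla _ (by simp)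
  let φ : M.g (-1) →ₗ[ℂ] (Filiform.gla μ).g (-1) :=
    (α ∘ₗ (M.g (-1)).subtype).smulRight ⟨x, hx⟩ + (β ∘ₗ (M.g (-1)).subtype).smulRight ⟨y, hy⟩
  have hφ : ∀ z, (φ z : Filiform μ) = α z • x + β z • y := fun z => rfl
  obtain ⟨Φ, ⟨-, -, hΦ⟩, -⟩ := hfree _ (Filiform.gla μ) _ _ hF (Filiform.isOfKind hμ0) φ
    (by
      rintro ⟨z, hz⟩
      obtain ⟨z₁, h₁, z₂, h₂, rfl⟩ := Submodule.mem_sup.mp (hF.sup_eq.symm ▸ hz : z ∈ _ ⊔ _)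
      obtain ⟨a, rfl⟩ := Submodule.mem_span_singleton.mp h₁
      obtain ⟨b, rfl⟩ := Submodule.mem_span_singleton.mp h₂
      refine ⟨a • ⟨u, hpp.e_le hu⟩ + b • ⟨w, hpp.f_le hw⟩, Subtype.ext ?_⟩
      rw [hφ]
      simp [hαu, hβw, hαf w hw, hβe u hu])
    (fun z hz hze => by
      rw [hφ]
      simpa [hβe z hze] using Submodule.smul_mem _ _ (Submodule.mem_span_singleton_self x))
    (fun z hz hzf => by
      rw [hφ]
      simpa [hαf z hzf] using Submodule.smul_mem _ _ (Submodule.mem_span_singleton_self y))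
  have hΦu : Φ u = x := by
    rw [hΦ ⟨u, hpp.e_le hu⟩, hφ]
    simp [hαu, hβe u hu]
  have hΦw : Φ w = y := by
    rw [hΦ ⟨w, hpp.f_le hw⟩, hφ]
    simp [hβw, hαf w hw]
  have hΦv : Φ v = β v • y := by
    rw [hΦ ⟨v, hpp.f_le hv⟩, hφ]
    simp [hαf v hv]
  have hzero := congrArg Φ (hc ⁅u, w⁆ (M.bracket_mem (-1) (-1) u (hpp.e_le hu) w (hpp.f_le hw)))
  rw [LieHom.map_lie, LieHom.map_lie, map_add, hΦu, hΦv, hΦw, map_zero] at hzero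
  exact Filiform.lie_lie_ne_zero hμ _ hzero

end NotFree

/-- Proposition 8.4: for a pseudo-product FGLA of the `μ`-th kind whose pseudo-product
prolongation has `g₀ ≅ gl(e) ⊕ gl(f)`, with `c` the centralizer of `g₋₂` in `g₋₁`:
(1) if `μ = 2` it is free; (2) if `μ ≥ 3` and `c ≠ 0` it is not free;
(3) if `μ = 3` and `c = 0` it is free. -/
theorem pp_fgla_freeness_criterion {Lm LG : Type} [LieRing Lm] [LieAlgebra ℂ Lm]
    [LieRing LG] [LieAlgebra ℂ LG]
    (M : GLA Lm) (e f : Submodule ℂ Lm) (μ : ℕ) (hμ : 2 ≤ μ)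
    (hpp : IsPPFGLA M e f) (hkind : M.IsOfKind μ)
    (G : GLA LG) (ι : Lm →ₗ⁅ℂ⁆ LG) (hprol : IsPPProlongation M e f G ι)
    (c : Submodule ℂ Lm)
    (hc : ∀ x : Lm, x ∈ c ↔ x ∈ M.g (-1) ∧ ∀ z ∈ M.g (-2), ⁅x, z⁆ = 0)
    (hgl : ∃ Φ : (G.g 0) → Module.End ℂ e × Module.End ℂ f,
      (∀ (X : G.g 0) (y : e), ι (((Φ X).1 y : Lm)) = ⁅(X : LG), ι (y : Lm)⁆) ∧
      (∀ (X : G.g 0) (y : f), ι (((Φ X).2 y : Lm)) = ⁅(X : LG), ι (y : Lm)⁆) ∧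
      Function.Bijective Φ ∧
      (∀ X Y Z : G.g 0, (Z : LG) = ⁅(X : LG), (Y : LG)⁆ →
        (Φ Z).1 = ⁅(Φ X).1, (Φ Y).1⁆ ∧ (Φ Z).2 = ⁅(Φ X).2, (Φ Y).2⁆)) :
    (μ = 2 → IsFreePPFGLA M e f (Module.finrank ℂ e) (Module.finrank ℂ f) μ) ∧
    (3 ≤ μ → c ≠ ⊥ →
      ¬ IsFreePPFGLA M e f (Module.finrank ℂ e) (Module.finrank ℂ f) μ) ∧
    (μ = 3 → c = ⊥ →
      IsFreePPFGLA M e f (Module.finrank ℂ e) (Module.finrank ℂ f) μ) := by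
  obtain ⟨Φ, hΦe, hΦf, hΦ, -⟩ := hgl
  have hact : ∀ A B, ∃ X, ActsThrough ι e.subtype X A ∧ ActsThrough ι f.subtype X B := by
    intro A B
    obtain ⟨X, hX⟩ := hΦ.surjective (A, B)
    refine ⟨X, fun x => ?_, fun y => ?_⟩
    · simpa [hX] using (hΦe X x).symm
    · simpa [hX] using (hΦf X y).symm
  refine ⟨fun h2 => ?_, fun h3 hne hfree => hne (eq_bot_iff.mpr fun x hx => ?_), fun h3 hbot => ?_⟩
  · exact hpp.isFree hμ hkind (by lia) hprol.inj hact (by lia)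
  · obtain ⟨hx₁, hx₂⟩ := (hc x).mp hx
    rw [← hpp.sup_eq] at hx₁
    obtain ⟨u, hu, v, hv, rfl⟩ := Submodule.mem_sup.mp hx₁
    rw [Submodule.mem_bot, hfree.eq_zero_of_centralizes h3 hu hv hx₂,
      hfree.swap.eq_zero_of_centralizes h3 hv hu (by rwa [add_comm v u]), add_zero]
  · refine hpp.isFree hμ hkind h3.le hprol.inj hact fun _ x hx hz => ?_
    simpa [hbot] using (hc x).mpr ⟨hx, hz⟩
end

section
/- Let (m; e, f) be a free pseudo-product fundamental graded Lie algebra of type (m, n, μ) over ℂ, and let g = ⊕_{p∈ℤ} g_p be the prolongation of (m; e, f). Then the map Φ: Aut(g; e, f)_0 → GL(e) × GL(f), φ ↦ (φ|e, φ|f), is a group isomorphism, where Aut(g; e, f)_0 = {φ ∈ Aut(g) : φ(g_p) = g_p for all p, φ(e) = e, φ(f) = f}. Furthermore, if dim e ≠ dim f, then Aut(g; e, f)_0 = Aut(g)_0, the group of all gradation-preserving automorphisms of g. -/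
open scoped TensorProduct

namespace GLA

variable {L : Type} [LieRing L] [LieAlgebra ℂ L]

/-- Homogeneous components of a grading, as linear projections. -/
lemma exists_proj (G : GLA L) : ∃ π : ℤ → L →ₗ[ℂ] L,
    (∀ p, ∀ x ∈ G.g p, π p x = x) ∧ ∀ p q, q ≠ p → ∀ x ∈ G.g q, π p x = 0 := by
  classical
  let E := LinearEquiv.ofBijective (DirectSum.coeLinearMap G.g) G.internal
  have hE (q : ℤ) (x : L) (hx : x ∈ G.g q) :
      E.symm x = DirectSum.lof ℂ ℤ (fun p => G.g p) q ⟨x, hx⟩ := by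
    rw [LinearEquiv.symm_apply_eq]
    exact (DirectSum.coeLinearMap_lof G.g q ⟨x, hx⟩).symm
  refine ⟨fun p => (G.g p).subtype ∘ₗ DirectSum.component ℂ ℤ (fun p => G.g p) p ∘ₗ
    E.symm.toLinearMap, ?_, ?_⟩
  · intro p x hx
    simp [hE p x hx, DirectSum.component.lof_self]
  · intro p q hpq x hx
    simp [hE q x hx, DirectSum.component.of, hpq]

lemma iSupIndep_of_proj {V : Type*} [AddCommGroup V] [Module ℂ V] (A : ℤ → Submodule ℂ V)
    (π : ℤ → V →ₗ[ℂ] V) (h₁ : ∀ p, ∀ x ∈ A p, π p x = x)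
    (h₂ : ∀ p q, q ≠ p → ∀ x ∈ A q, π p x = 0) : iSupIndep A := by
  intro p
  rw [Submodule.disjoint_def]
  intro x hx hx'
  have hle : (⨆ q, ⨆ (_ : q ≠ p), A q) ≤ LinearMap.ker (π p) :=
    iSup₂_le fun q hq y hy => LinearMap.mem_ker.2 (h₂ p q hq y hy)
  rw [← h₁ p x hx]
  exact LinearMap.mem_ker.1 (hle hx')

/-- In an FGLA, a filtration of subspaces that contains `g₋₁` and is compatible with brackets by
`g₋₁` contains every homogeneous component. -/
lemma IsFGLA.g_le {G : GLA L} (hG : G.IsFGLA) (S : ℕ → Submodule ℂ L) (h₁ : G.g (-1) ≤ S 0)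
    (hS : ∀ j, ∀ x ∈ S j, ∀ y ∈ G.g (-1), ⁅x, y⁆ ∈ S (j + 1)) (j : ℕ) :
    G.g (-1 - j) ≤ S j := by
  induction j with
  | zero => simpa using h₁
  | succ j ih =>
    have h := hG.generated (-1 - j) (by omega)
    rw [show (-1 - ((j + 1 : ℕ) : ℤ)) = -1 - (j : ℤ) - 1 by push_cast; ring, h, Submodule.span_le]
    rintro _ ⟨x, hx, y, hy, rfl⟩
    exact hS j x (ih hx) y hy

lemma eq_top_of_forall_g_le (G : GLA L) (S : Submodule ℂ L) (h : ∀ p, G.g p ≤ S) : S = ⊤ := by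
  rw [eq_top_iff, ← G.internal.submodule_iSup_eq_top]
  exact iSup_le h

/-- An FGLA is the only subspace of itself which contains `g₋₁` and is stable under brackets by
`g₋₁`. -/
lemma IsFGLA.eq_top_s17 {G : GLA L} (hG : G.IsFGLA) (S : Submodule ℂ L) (h₁ : G.g (-1) ≤ S)
    (hS : ∀ x ∈ S, ∀ y ∈ G.g (-1), ⁅x, y⁆ ∈ S) : S = ⊤ := by
  refine G.eq_top_of_forall_g_le S fun p => ?_
  rcases le_or_gt 0 p with hp | hp
  · simp [hG.nonneg p hp]
  · have := hG.g_le (fun _ => S) h₁ (fun _ => hS) (-1 - p).toNat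
    rwa [show -1 - ((-1 - p).toNat : ℤ) = p by omega] at this

/-- An injective graded endomorphism of a GLA maps each component onto itself. -/
lemma map_eq_of_injective (G : GLA L) (ψ : L →ₗ[ℂ] L) (hψ : Function.Injective ψ)
    (h : ∀ p, (G.g p).map ψ ≤ G.g p) (p : ℤ) : (G.g p).map ψ = G.g p := by
  have := G.findim p
  exact Submodule.eq_of_le_of_finrank_eq (h p)
    (Submodule.equivMapOfInjective ψ hψ (G.g p)).symm.finrank_eq

lemma surjective_of_map_eq (G : GLA L) (ψ : L →ₗ[ℂ] L)
    (h : ∀ p, (G.g p).map ψ = G.g p) : Function.Surjective ψ := by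
  rw [← LinearMap.range_eq_top]
  refine G.eq_top_of_forall_g_le _ fun p => ?_
  rw [← h p]
  exact LinearMap.map_le_range

end GLA

/-- In a free pseudo-product FGLA, a linear map preserving `e` and `f` and mapping `g₋₁` onto
itself extends to a graded automorphism. -/
lemma IsFreePPFGLA.exists_lieHom {L : Type} [LieRing L] [LieAlgebra ℂ L] {M : GLA L}
    {e f : Submodule ℂ L} {m n μ : ℕ} (h : IsFreePPFGLA M e f m n μ) (B : L →ₗ[ℂ] L)
    (he : ∀ x ∈ e, B x ∈ e) (hf : ∀ x ∈ f, B x ∈ f)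
    (hB : ∀ y ∈ M.g (-1), ∃ x ∈ M.g (-1), B x = y) :
    ∃ Φ : L →ₗ⁅ℂ⁆ L, Function.Injective Φ ∧ (∀ p, (M.g p).map Φ.toLinearMap = M.g p) ∧
      ∀ x ∈ M.g (-1), Φ x = B x := by
  obtain ⟨hpp, hk, -, -, huniv⟩ := h
  have hB' : ∀ x ∈ M.g (-1), B x ∈ M.g (-1) := by
    intro x hx
    rw [← hpp.sup_eq] at hx ⊢
    obtain ⟨a, ha, b, hb, rfl⟩ := Submodule.mem_sup.1 hx
    rw [map_add]
    exact Submodule.add_mem_sup (he a ha) (hf b hb)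
  obtain ⟨Φ, ⟨hg, hs, hx⟩, -⟩ := huniv L M e f hpp hk (B.restrict hB')
    (fun y => by
      obtain ⟨x, hx, hxy⟩ := hB y y.2
      exact ⟨⟨x, hx⟩, Subtype.ext hxy⟩)
    (fun x _ hxe => he x hxe) (fun x _ hxf => hf x hxf)
  have := hpp.fgla.fd
  have hinj : Function.Injective Φ.toLinearMap := LinearMap.injective_iff_surjective.2 hs
  refine ⟨Φ, hinj, M.map_eq_of_injective Φ.toLinearMap hinj fun p => ?_, fun x h => hx ⟨x, h⟩⟩
  rintro _ ⟨x, hx, rfl⟩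
  exact hg p x hx

/-- A derivation given by the interpolation of the logarithm of a semisimple automorphism. -/
lemma exists_derivation_of_lieHom {L : Type} [LieRing L] [LieAlgebra ℂ L] (Φ : L →ₗ⁅ℂ⁆ L) (N : ℕ)
    (hN : Submodule.span ℂ {x : L | ∃ k ≤ N, Φ x = (2 : ℂ) ^ k • x} = ⊤) :
    ∃ D : LieDerivation ℂ L L, ∀ k ≤ N, ∀ x, Φ x = (2 : ℂ) ^ k • x → D x = (k : ℂ) • x := by
  classical
  let q : Polynomial ℂ := Lagrange.interpolate (Finset.range (2 * N + 1)) (fun k => (2 : ℂ) ^ k)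
    (fun k => (k : ℂ))
  have hinj : Function.Injective (fun k : ℕ => (2 : ℂ) ^ k) := by
    intro a b hab
    have h' : ((2 ^ a : ℕ) : ℂ) = ((2 ^ b : ℕ) : ℂ) := by
      push_cast
      exact hab
    exact Nat.pow_right_injective le_rfl (Nat.cast_injective h')
  have hq (k : ℕ) (hk : k ≤ 2 * N) : q.eval ((2 : ℂ) ^ k) = k :=
    Lagrange.eval_interpolate_at_node (v := fun k : ℕ => (2 : ℂ) ^ k) (fun k : ℕ => (k : ℂ))
      hinj.injOn (Finset.mem_range.2 (by omega))
  let d : L →ₗ[ℂ] L := Polynomial.aeval (R := ℂ) (A := Module.End ℂ L) Φ.toLinearMap q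
  have hd (k : ℕ) (hk : k ≤ 2 * N) (x : L) (hx : Φ x = (2 : ℂ) ^ k • x) : d x = (k : ℂ) • x := by
    rw [← hq k hk]
    exact Module.End.aeval_apply_of_mem_apply_eq_smul (f := Φ.toLinearMap) hx
  have hleib (x y : L) : d ⁅x, y⁆ = ⁅x, d y⁆ - ⁅y, d x⁆ := by
    have hx : x ∈ Submodule.span ℂ {x : L | ∃ k ≤ N, Φ x = (2 : ℂ) ^ k • x} := hN ▸ trivial
    have hy : y ∈ Submodule.span ℂ {x : L | ∃ k ≤ N, Φ x = (2 : ℂ) ^ k • x} := hN ▸ trivial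
    induction hx, hy using Submodule.span_induction₂ with
    | mem_mem x y hx hy =>
      obtain ⟨k, hk, hx⟩ := hx
      obtain ⟨l, hl, hy⟩ := hy
      rw [hd k (by omega) x hx, hd l (by omega) y hy, hd (k + l) (by omega) ⁅x, y⁆
        (by rw [LieHom.map_lie, hx, hy, smul_lie, lie_smul, smul_smul, pow_add]),
        lie_smul, lie_smul, ← lie_skew x y]
      push_cast
      module
    | zero_left y => simp
    | zero_right x => simp
    | add_left x y z hx hy hz h₁ h₂ => simp only [add_lie, lie_add, map_add, h₁, h₂]; abel
    | add_right x y z hx hy hz h₁ h₂ => simp only [add_lie, lie_add, map_add, h₁, h₂]; abel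
    | smul_left r x y hx hy h => simp only [smul_lie, lie_smul, map_smul, h, smul_sub]
    | smul_right r x y hx hy h => simp only [smul_lie, lie_smul, map_smul, h, smul_sub]
  exact ⟨⟨d, hleib⟩, fun k hk x hx => hd k (by omega) x hx⟩

/-- In a free pseudo-product FGLA, an idempotent map preserving `e` and `f` extends to a
derivation. -/
lemma IsFreePPFGLA.exists_derivation {L : Type} [LieRing L] [LieAlgebra ℂ L] {M : GLA L}
    {e f : Submodule ℂ L} {m n μ : ℕ} (h : IsFreePPFGLA M e f m n μ) (A : L →ₗ[ℂ] L)
    (he : ∀ x ∈ e, A x ∈ e) (hf : ∀ x ∈ f, A x ∈ f) (hA : ∀ x, A (A x) = A x) :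
    ∃ D : LieDerivation ℂ L L, (∀ p, ∀ x ∈ M.g p, D x ∈ M.g p) ∧
      ∀ x ∈ M.g (-1), D x = A x := by
  have hA₁ : ∀ x ∈ M.g (-1), A x ∈ M.g (-1) := by
    intro x hx
    rw [← h.1.sup_eq] at hx ⊢
    obtain ⟨a, ha, b, hb, rfl⟩ := Submodule.mem_sup.1 hx
    rw [map_add]
    exact Submodule.add_mem_sup (he a ha) (hf b hb)
  obtain ⟨Φ, -, hmap, hΦ⟩ := h.exists_lieHom (LinearMap.id + A)
    (fun x hx => e.add_mem hx (he x hx)) (fun x hx => f.add_mem hx (hf x hx))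
    (fun y hy => ⟨y - (2⁻¹ : ℂ) • A y, (M.g (-1)).sub_mem hy ((M.g (-1)).smul_mem _ (hA₁ y hy)), by
      simp only [LinearMap.add_apply, LinearMap.id_apply, map_sub, map_smul, hA]
      module⟩)
  have hΦ₀ (x : L) (hx : x ∈ M.g (-1)) : Φ (x - A x) = (2 : ℂ) ^ 0 • (x - A x) := by
    rw [hΦ _ ((M.g (-1)).sub_mem hx (hA₁ x hx))]
    simp [hA]
  have hΦ₁ (x : L) (hx : x ∈ M.g (-1)) : Φ (A x) = (2 : ℂ) ^ 1 • A x := by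
    rw [hΦ _ (hA₁ x hx)]
    simp only [LinearMap.add_apply, LinearMap.id_apply, hA]
    module
  let S : ℕ → Submodule ℂ L := fun j =>
    Submodule.span ℂ {x : L | ∃ k ≤ j + 1, Φ x = (2 : ℂ) ^ k • x}
  have hS_mono : Monotone S := fun i j hij =>
    Submodule.span_mono fun x ⟨k, hk, hx⟩ => ⟨k, by omega, hx⟩
  have hle (j : ℕ) : M.g (-1 - j) ≤ S j := by
    have h₁ : M.g (-1) ≤ S 0 := by
      intro x hx
      rw [← sub_add_cancel x (A x)]
      exact add_mem (Submodule.subset_span ⟨0, by omega, hΦ₀ x hx⟩)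
        (Submodule.subset_span ⟨1, by omega, hΦ₁ x hx⟩)
    refine h.1.fgla.g_le S h₁ (fun j x hx y hy => ?_) j
    have hy' := h₁ hy
    clear hy
    induction hx, hy' using Submodule.span_induction₂ with
    | mem_mem x y hx hy =>
      obtain ⟨k, hk, hx⟩ := hx
      obtain ⟨l, hl, hy⟩ := hy
      exact Submodule.subset_span ⟨k + l, by omega,
        by rw [LieHom.map_lie, hx, hy, smul_lie, lie_smul, smul_smul, pow_add]⟩
    | zero_left y => simp
    | zero_right x => simp
    | add_left x y z hx hy hz h₁ h₂ => rw [add_lie]; exact add_mem h₁ h₂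
    | add_right x y z hx hy hz h₁ h₂ => rw [lie_add]; exact add_mem h₁ h₂
    | smul_left r x y hx hy h => rw [smul_lie]; exact Submodule.smul_mem _ _ h
    | smul_right r x y hx hy h => rw [lie_smul]; exact Submodule.smul_mem _ _ h
  have htop : S μ = ⊤ := by
    refine M.eq_top_of_forall_g_le _ fun p => ?_
    rcases le_or_gt 0 p with hp | hp
    · simp [h.1.fgla.nonneg p hp]
    rcases lt_or_ge p (-(μ : ℤ)) with hp' | hp'
    · simp [h.2.1.2 p hp']
    · have := hle (-1 - p).toNat
      rw [show -1 - ((-1 - p).toNat : ℤ) = p by omega] at this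
      exact this.trans (hS_mono (by omega))
  obtain ⟨D, hD⟩ := exists_derivation_of_lieHom Φ (μ + 1) htop
  have hDA : ∀ x ∈ M.g (-1), D x = A x := by
    intro x hx
    rw [← sub_add_cancel x (A x), map_add, hD 0 (by omega) _ (hΦ₀ x hx),
      hD 1 (by omega) _ (hΦ₁ x hx)]
    simp
  refine ⟨D, fun p => ?_, hDA⟩
  rcases le_or_gt 0 p with hp | hp
  · intro x hx
    rw [h.1.fgla.nonneg p hp, Submodule.mem_bot] at hx
    simp [hx]
  · have := h.1.fgla.g_le
      (fun j : ℕ => M.g (-1 - (j : ℤ)) ⊓ (M.g (-1 - (j : ℤ))).comap D.toLinearMap)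
      (fun x hx => ?_) (fun j x hx y hy => ?_) (-1 - p).toNat
    · rw [show -1 - ((-1 - p).toNat : ℤ) = p by omega] at this
      exact fun x hx => (this hx).2
    · simp only [Nat.cast_zero, sub_zero]
      refine ⟨hx, ?_⟩
      change D x ∈ M.g (-1)
      rw [hDA x hx]
      exact hA₁ x hx
    · rw [show (-1 - ((j + 1 : ℕ) : ℤ)) = -1 - (j : ℤ) + -1 by push_cast; ring]
      refine ⟨M.bracket_mem _ _ x hx.1 y hy, ?_⟩
      change D ⁅x, y⁆ ∈ M.g (-1 - (j : ℤ) + -1)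
      rw [LieDerivation.apply_lie_eq_add]
      refine add_mem (M.bracket_mem _ _ x hx.1 _ ?_) (M.bracket_mem _ _ _ hx.2 y hy)
      rw [hDA y hy]
      exact hA₁ y hy

section Extension

attribute [local instance] LieRing.ofAssociativeRing

/-- The one-dimensional semidirect extension of an FGLA by a gradation-preserving derivation
placed in degree zero. -/
lemma GLA.IsFGLA.exists_extension {L : Type} [LieRing L] [LieAlgebra ℂ L] {M : GLA L}
    (hM : M.IsFGLA) (D : LieDerivation ℂ L L) (hD : ∀ p, ∀ x ∈ M.g p, D x ∈ M.g p)
    (ψ : ℂ →ₗ⁅ℂ⁆ LieDerivation ℂ L L) (hψ : ∀ c, ψ c = c • D) :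
    ∃ H : GLA (LieAlgebra.SemiDirectSum L ℂ ψ),
      ∀ p x, x ∈ H.g p ↔ x.left ∈ M.g p ∧ (p ≠ 0 → x.right = 0) := by
  let A : ℤ → Submodule ℂ (LieAlgebra.SemiDirectSum L ℂ ψ) := fun p =>
    { carrier := {x | x.left ∈ M.g p ∧ (p ≠ 0 → x.right = 0)}
      zero_mem' := ⟨(M.g p).zero_mem, fun _ => rfl⟩
      add_mem' := fun {x y} hx hy => ⟨(M.g p).add_mem hx.1 hy.1, fun hp => by
        simp [hx.2 hp, hy.2 hp]⟩
      smul_mem' := fun c x hx => ⟨(M.g p).smul_mem c hx.1, fun hp => by simp [hx.2 hp]⟩ }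
  have hfd : FiniteDimensional ℂ L := hM.fd
  have hfd' : FiniteDimensional ℂ (LieAlgebra.SemiDirectSum L ℂ ψ) :=
    (LieAlgebra.SemiDirectSum.toProdl ψ).symm.finiteDimensional
  refine ⟨⟨A, ?_, ?_, fun p => inferInstance⟩, fun p x => Iff.rfl⟩
  · obtain ⟨π, hπ₁, hπ₂⟩ := M.exists_proj
    refine DirectSum.isInternal_submodule_of_iSupIndep_of_iSup_eq_top
      (GLA.iSupIndep_of_proj A (fun p =>
        (LieAlgebra.SemiDirectSum.toProdl ψ).symm.toLinearMap ∘ₗ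
          LinearMap.prodMap (π p) (if p = 0 then LinearMap.id else 0) ∘ₗ
          (LieAlgebra.SemiDirectSum.toProdl ψ).toLinearMap) ?_ ?_) ?_
    · rintro p ⟨a, c⟩ ⟨ha, hc⟩
      apply (LieAlgebra.SemiDirectSum.toProdl ψ).injective
      by_cases hp : p = 0
      · simpa [hp] using hπ₁ p a ha
      · have hc : c = 0 := hc hp
        simp [hπ₁ p a ha, hp, hc]
    · rintro p q hpq ⟨a, c⟩ ⟨ha, hc⟩
      apply (LieAlgebra.SemiDirectSum.toProdl ψ).injective
      have h0 := hπ₂ p q hpq a ha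
      by_cases hp : p = 0
      · have hc : c = 0 := hc (by omega)
        subst hp
        simp [h0, hc]
      · simp [h0, hp]
    · rw [eq_top_iff]
      rintro ⟨a, c⟩ -
      have ha : a ∈ (⨆ p, A p).comap (LieAlgebra.SemiDirectSum.inl ψ).toLinearMap := by
        rw [M.eq_top_of_forall_g_le ((⨆ p, A p).comap _) fun p x hx => ?_]
        · trivial
        · exact (le_iSup A p) (show _ ∈ A p from ⟨hx, fun _ => rfl⟩)
      have hc : (⟨0, c⟩ : LieAlgebra.SemiDirectSum L ℂ ψ) ∈ ⨆ p, A p :=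
        (le_iSup A 0) ⟨(M.g 0).zero_mem, fun h => absurd rfl h⟩
      simpa using add_mem (S := Submodule ℂ (LieAlgebra.SemiDirectSum L ℂ ψ))
        (Submodule.mem_comap.1 ha) hc
  · intro p q x hx y hy
    have key : ∀ (r s : ℤ) (u v : LieAlgebra.SemiDirectSum L ℂ ψ), u ∈ A r → v ∈ A s →
        ψ u.right v.left ∈ M.g (r + s) := by
      intro r s u v hu hv
      rw [hψ]
      by_cases hr : r = 0
      · rw [hr, zero_add]
        exact (M.g s).smul_mem _ (hD s _ hv.1)
      · simp [hu.2 hr]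
    refine ⟨?_, fun _ => ?_⟩
    · exact sub_mem (add_mem (M.bracket_mem p q _ hx.1 _ hy.1) (key p q x y hx hy))
        (add_comm q p ▸ key q p y x hy hx)
    · change x.right * y.right - y.right * x.right = 0
      ring

variable {Lm LG : Type} [LieRing Lm] [LieAlgebra ℂ Lm] [LieRing LG] [LieAlgebra ℂ LG]
  {M : GLA Lm} {e f : Submodule ℂ Lm} {G : GLA LG} {ι : Lm →ₗ⁅ℂ⁆ LG}

/-- A gradation-preserving derivation of `m` preserving `e` and `f` is realized by an element of
degree zero of the prolongation. -/
lemma IsPPProlongation.exists_mem_zero (hprol : IsPPProlongation M e f G ι) (hM : M.IsFGLA)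
    (D : LieDerivation ℂ Lm Lm) (hD : ∀ p, ∀ x ∈ M.g p, D x ∈ M.g p)
    (he : ∀ x ∈ e, D x ∈ e) (hf : ∀ x ∈ f, D x ∈ f) :
    ∃ X ∈ G.g 0, ∀ x, ⁅X, ι x⁆ = ι (D x) := by
  by_cases h0 : D = 0
  · exact ⟨0, zero_mem _, fun x => by simp [h0]⟩
  let ψ : ℂ →ₗ⁅ℂ⁆ LieDerivation ℂ Lm Lm :=
    { LinearMap.toSpanSingleton ℂ (LieDerivation ℂ Lm Lm) D with
      map_lie' := fun {a b} => by
        have : ⁅a, b⁆ = 0 := by rw [Ring.lie_def, mul_comm, sub_self]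
        simp [this] }
  have hψ (c : ℂ) : ψ c = c • D := rfl
  obtain ⟨H, hH⟩ := hM.exists_extension D hD ψ hψ
  have hbr (c : ℂ) (u y : Lm) : ⁅(⟨u, c⟩ : LieAlgebra.SemiDirectSum Lm ℂ ψ),
      LieAlgebra.SemiDirectSum.inl ψ y⁆ = LieAlgebra.SemiDirectSum.inl ψ (⁅u, y⁆ + c • D y) := by
    simp [hψ]
  have hleft (x : LieAlgebra.SemiDirectSum Lm ℂ ψ) (p : ℤ) (hp : 0 ≤ p) (hx : x ∈ H.g p) :
      x.left = 0 := by
    have := ((hH p x).1 hx).1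
    rwa [hM.nonneg p hp, Submodule.mem_bot] at this
  have hneg (p : ℤ) (hp : p < 0) :
      (M.g p).map (LieAlgebra.SemiDirectSum.inl ψ).toLinearMap = H.g p := by
    ext x
    rw [hH]
    constructor
    · rintro ⟨y, hy, rfl⟩
      exact ⟨hy, fun _ => rfl⟩
    · rintro ⟨hl, hr⟩
      exact ⟨x.left, hl, LieAlgebra.SemiDirectSum.ext rfl (hr hp.ne).symm⟩
  have htrans : H.Transitive := by
    rintro p hp ⟨u, c⟩ hx hker
    obtain rfl : u = 0 := hleft _ p hp hx
    have hcD : ∀ y, c • D y = 0 := by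
      have := M.eq_top_of_forall_g_le (LinearMap.ker (c • D.toLinearMap)) fun q y hy => by
        rcases le_or_gt 0 q with hq | hq
        · rw [hM.nonneg q hq, Submodule.mem_bot] at hy
          simp [hy]
        · have := hker q hq (LieAlgebra.SemiDirectSum.inl ψ y)
            (by rw [← hneg q hq]; exact ⟨y, hy, rfl⟩)
          rw [hbr] at this
          simpa using this
      intro y
      exact LinearMap.mem_ker.1 (this ▸ Submodule.mem_top : y ∈ LinearMap.ker (c • D.toLinearMap))
    have hc : c = 0 := by
      by_contra hc
      exact h0 (LieDerivation.ext fun y => (smul_eq_zero.1 (hcD y)).resolve_left hc)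
    rw [hc]
    rfl
  have hstab (V : Submodule ℂ Lm) (hV : ∀ x ∈ V, D x ∈ V) : ∀ x ∈ H.g 0, ∀ y ∈ V,
      ⁅x, LieAlgebra.SemiDirectSum.inl ψ y⁆ ∈
        V.map (LieAlgebra.SemiDirectSum.inl ψ).toLinearMap := by
    rintro ⟨u, c⟩ hx y hy
    obtain rfl : u = 0 := hleft _ 0 le_rfl hx
    rw [hbr]
    exact ⟨_, by simpa using V.smul_mem c (hV y hy), rfl⟩
  obtain ⟨χ, -, hχ, hχι⟩ := hprol.max _ H (LieAlgebra.SemiDirectSum.inl ψ)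
    (LieAlgebra.SemiDirectSum.inl_injective ψ) hneg htrans (hstab e he) (hstab f hf)
  refine ⟨χ ⟨0, 1⟩, hχ 0 ⟨_, (hH 0 _).2 ⟨zero_mem _, fun h => absurd rfl h⟩, rfl⟩, fun x => ?_⟩
  rw [← hχι, LieHom.comp_apply, LieHom.comp_apply, ← LieHom.map_lie, hbr]
  simp

end Extension

section Prolongation

variable {Lm LG : Type} [LieRing Lm] [LieAlgebra ℂ Lm] [LieRing LG] [LieAlgebra ℂ LG]
  {M : GLA Lm} {e f : Submodule ℂ Lm} {G : GLA LG} {ι : Lm →ₗ⁅ℂ⁆ LG}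

/-- An automorphism of `(m; e, f)` extends to a graded automorphism of the prolongation. -/
lemma IsPPProlongation.exists_lieEquiv (hprol : IsPPProlongation M e f G ι)
    (Φ : Lm →ₗ⁅ℂ⁆ Lm) (hinj : Function.Injective Φ)
    (hmap : ∀ p, (M.g p).map Φ.toLinearMap = M.g p)
    (he : e.map Φ.toLinearMap = e) (hf : f.map Φ.toLinearMap = f) :
    ∃ φ : LG ≃ₗ⁅ℂ⁆ LG,
      (∀ p, (G.g p).map (φ : LG →ₗ⁅ℂ⁆ LG).toLinearMap = G.g p) ∧ ∀ x, φ (ι x) = ι (Φ x) := by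
  have hcomp (V : Submodule ℂ Lm) (hV : V.map Φ.toLinearMap = V) :
      V.map (ι.comp Φ).toLinearMap = V.map ι.toLinearMap := by
    rw [show (ι.comp Φ).toLinearMap = ι.toLinearMap ∘ₗ Φ.toLinearMap from rfl,
      Submodule.map_comp, hV]
  have hstab (V : Submodule ℂ Lm) (hV : V.map Φ.toLinearMap = V)
      (h : ∀ x ∈ G.g 0, ∀ y ∈ V, ⁅x, ι y⁆ ∈ V.map ι.toLinearMap) :
      ∀ x ∈ G.g 0, ∀ y ∈ V, ⁅x, ι.comp Φ y⁆ ∈ V.map (ι.comp Φ).toLinearMap := by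
    intro x hx y hy
    rw [hcomp V hV]
    exact h x hx (Φ y) (hV ▸ Submodule.mem_map_of_mem (f := Φ.toLinearMap) hy)
  obtain ⟨χ, hχ, hχg, hχι⟩ := hprol.max LG G (ι.comp Φ) (hprol.inj.comp hinj)
    (fun p hp => (hcomp _ (hmap p)).trans (hprol.graded_neg p hp)) hprol.trans
    (hstab e he hprol.e_stable) (hstab f hf hprol.f_stable)
  have hχm := G.map_eq_of_injective χ.toLinearMap hχ hχg
  let χe : LG ≃ₗ⁅ℂ⁆ LG := LieEquiv.ofBijective χ ⟨hχ, G.surjective_of_map_eq χ.toLinearMap hχm⟩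
  have hχe (x : LG) : χe x = χ x := rfl
  refine ⟨χe.symm, fun p => ?_, fun x => ?_⟩
  · refine le_antisymm ?_ fun x hx => ⟨χ x, hχm p ▸ ⟨x, hx, rfl⟩, ?_⟩
    · rintro _ ⟨x, hx, rfl⟩
      rw [← hχm p] at hx
      obtain ⟨y, hy, rfl⟩ := hx
      have : χe.symm (χ y) = y := χe.symm_apply_apply y
      exact this.symm ▸ hy
    · exact χe.symm_apply_apply x
  · rw [← LieHom.congr_fun hχι x]
    exact χe.symm_apply_apply (ι (Φ x))

/-- Graded automorphisms of the prolongation are determined by their restriction to `g₋₁`. -/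
lemma IsPPProlongation.lieEquiv_ext (hprol : IsPPProlongation M e f G ι) (hM : M.IsFGLA)
    (φ φ' : LG ≃ₗ⁅ℂ⁆ LG)
    (hφ : ∀ p, (G.g p).map (φ : LG →ₗ⁅ℂ⁆ LG).toLinearMap = G.g p)
    (hφ' : ∀ p, (G.g p).map (φ' : LG →ₗ⁅ℂ⁆ LG).toLinearMap = G.g p)
    (h : ∀ x ∈ M.g (-1), φ (ι x) = φ' (ι x)) : φ = φ' := by
  have hι : ∀ x, φ (ι x) = φ' (ι x) := by
    let S : Submodule ℂ Lm := LinearMap.eqLocus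
      ((φ : LG →ₗ⁅ℂ⁆ LG).toLinearMap ∘ₗ ι.toLinearMap)
      ((φ' : LG →ₗ⁅ℂ⁆ LG).toLinearMap ∘ₗ ι.toLinearMap)
    have hS (x : Lm) : x ∈ S ↔ φ (ι x) = φ' (ι x) := Iff.rfl
    have : S = ⊤ := hM.eq_top_s17 S (fun x hx => h x hx) fun x hx y hy => by
      rw [hS] at hx ⊢
      rw [LieHom.map_lie, LieEquiv.map_lie, LieEquiv.map_lie, hx, h y hy]
    exact fun x => (hS x).1 (this ▸ trivial)
  have hneg (p : ℤ) (hp : p < 0) (x : LG) (hx : x ∈ G.g p) : φ x = φ' x := by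
    rw [← hprol.graded_neg p hp] at hx
    obtain ⟨y, -, rfl⟩ := hx
    exact hι y
  have hall (k : ℕ) : ∀ p : ℤ, p < k → ∀ x ∈ G.g p, φ x = φ' x := by
    induction k with
    | zero => exact fun p hp => hneg p (by simpa using hp)
    | succ k ih =>
      intro p hp x hx
      rcases lt_or_ge p 0 with hp0 | hp0
      · exact hneg p hp0 x hx
      rw [← sub_eq_zero]
      refine hprol.trans p hp0 _ (sub_mem (hφ p ▸ ⟨x, hx, rfl⟩) (hφ' p ▸ ⟨x, hx, rfl⟩)) ?_
      intro q hq y hy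
      rw [← hφ q] at hy
      obtain ⟨z, hz, rfl⟩ := hy
      change ⁅φ x - φ' x, φ z⁆ = 0
      rw [sub_lie, sub_eq_zero, ← LieEquiv.map_lie, hneg q hq z hz, ← LieEquiv.map_lie]
      exact ih (p + q) (by push_cast at hp; omega) _ (G.bracket_mem p q x hx z hz)
  have htop := G.eq_top_of_forall_g_le (LinearMap.eqLocus
      (φ : LG →ₗ⁅ℂ⁆ LG).toLinearMap (φ' : LG →ₗ⁅ℂ⁆ LG).toLinearMap)
    fun p x hx => hall (p.toNat + 1) p (by omega) x hx
  ext x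
  exact (htop ▸ trivial : x ∈ LinearMap.eqLocus
      (φ : LG →ₗ⁅ℂ⁆ LG).toLinearMap (φ' : LG →ₗ⁅ℂ⁆ LG).toLinearMap)

end Prolongation

section Invariant

variable {V : Type*} [AddCommGroup V] [Module ℂ V]

/-- A subspace of `e ⊕ f` stable under all idempotents preserving `e` and `f` lies in `e` or
contains `f`. -/
lemma le_or_le_of_idempotent_stable {e f W : Submodule ℂ V} (hW : W ≤ e ⊔ f)
    (hst : ∀ A : V →ₗ[ℂ] V, (∀ x ∈ e, A x ∈ e) → (∀ x ∈ f, A x ∈ f) → (∀ x, A (A x) = A x) →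
      ∀ x ∈ W, A x ∈ W) : W ≤ e ∨ f ≤ W := by
  refine or_iff_not_imp_left.2 fun hWe => ?_
  obtain ⟨w, hw, hwe⟩ := SetLike.not_le_iff_exists.1 hWe
  obtain ⟨a, ha, b, hb, rfl⟩ := Submodule.mem_sup.1 (hW hw)
  have hbe : b ∉ e := fun h => hwe (e.add_mem ha h)
  obtain ⟨l, hl, hle⟩ := Submodule.exists_le_ker_of_notMem hbe
  have hl₀ : ∀ x ∈ e, l x = 0 := fun x hx => LinearMap.mem_ker.1 (hle hx)
  have key : ∀ v ∈ f, l v = l b → v ∈ W := by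
    intro v hv hlv
    have := hst ((l b)⁻¹ • l.smulRight v) (fun x hx => by simp [hl₀ x hx])
      (fun x _ => f.smul_mem _ (f.smul_mem _ hv))
      (fun x => by simp [hlv, hl]) _ hw
    simpa [hl₀ a ha, smul_smul, hl] using this
  intro y hy
  have hbW := key b hb rfl
  have hv := key (y + (1 - (l b)⁻¹ * l y) • b) (f.add_mem hy (f.smul_mem _ hb)) (by
    simp only [map_add, map_smul, smul_eq_mul]
    field_simp
    ring)
  simpa using sub_mem hv (W.smul_mem (1 - (l b)⁻¹ * l y) hbW)

lemma eq_of_idempotent_stable [FiniteDimensional ℂ V] {e f W : Submodule ℂ V} (hd : e ⊓ f = ⊥)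
    (hW : W ≤ e ⊔ f) (hf : f ≠ ⊥)
    (hst : ∀ A : V →ₗ[ℂ] V, (∀ x ∈ e, A x ∈ e) → (∀ x ∈ f, A x ∈ f) → (∀ x, A (A x) = A x) →
      ∀ x ∈ W, A x ∈ W)
    (hr : Module.finrank ℂ W = Module.finrank ℂ e)
    (hne : Module.finrank ℂ e ≠ Module.finrank ℂ f) : W = e := by
  rcases le_or_le_of_idempotent_stable hW hst with h | h
  · exact Submodule.eq_of_le_of_finrank_eq h hr
  rcases le_or_le_of_idempotent_stable (sup_comm e f ▸ hW)
    (fun A h₁ h₂ => hst A h₂ h₁) with h' | h'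
  · exact absurd (hr.symm.trans (congrArg (fun U : Submodule ℂ V => Module.finrank ℂ U)
      (le_antisymm h' h))) hne
  · have heW := Submodule.eq_of_le_of_finrank_eq h' hr.symm
    rw [← heW] at h
    exact absurd (inf_eq_right.2 h ▸ hd) hf

end Invariant

section Main

variable {Lm LG : Type} [LieRing Lm] [LieAlgebra ℂ Lm] [LieRing LG] [LieAlgebra ℂ LG]
  {M : GLA Lm} {e f : Submodule ℂ Lm} {m n μ : ℕ} {G : GLA LG} {ι : Lm →ₗ⁅ℂ⁆ LG}

/-- A `g₀`-stable subspace `V` of `g₋₁` is moved by a graded automorphism of the prolongation to a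
subspace of `g₋₁` which is stable under all idempotents preserving `e` and `f`. -/
lemma IsPPProlongation.exists_map_eq (hprol : IsPPProlongation M e f G ι)
    (hfree : IsFreePPFGLA M e f m n μ) (φ : LG ≃ₗ⁅ℂ⁆ LG)
    (hφ : ∀ p, (G.g p).map (φ : LG →ₗ⁅ℂ⁆ LG).toLinearMap = G.g p)
    (V : Submodule ℂ Lm) (hV₁ : V ≤ M.g (-1))
    (hV : ∀ x ∈ G.g 0, ∀ y ∈ V, ⁅x, ι y⁆ ∈ V.map ι.toLinearMap) :
    ∃ W : Submodule ℂ Lm,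
      W.map ι.toLinearMap = (V.map ι.toLinearMap).map (φ : LG →ₗ⁅ℂ⁆ LG).toLinearMap ∧
      W ≤ e ⊔ f ∧ Module.finrank ℂ W = Module.finrank ℂ V ∧
      ∀ A : Lm →ₗ[ℂ] Lm, (∀ x ∈ e, A x ∈ e) → (∀ x ∈ f, A x ∈ f) → (∀ x, A (A x) = A x) →
        ∀ x ∈ W, A x ∈ W := by
  set U := (V.map ι.toLinearMap).map (φ : LG →ₗ⁅ℂ⁆ LG).toLinearMap with hU
  have hneg := hprol.graded_neg (-1) (by norm_num)
  have hUle : U ≤ (M.g (-1)).map ι.toLinearMap := by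
    rw [hneg, ← hφ (-1), ← hneg]
    exact Submodule.map_mono (Submodule.map_mono hV₁)
  have hmap : (U.comap ι.toLinearMap).map ι.toLinearMap = U :=
    Submodule.map_comap_eq_of_le (hUle.trans LinearMap.map_le_range)
  have hWle : U.comap ι.toLinearMap ≤ M.g (-1) := by
    intro x hx
    obtain ⟨y, hy, hxy⟩ := hUle hx
    exact hprol.inj hxy ▸ hy
  refine ⟨U.comap ι.toLinearMap, hmap, hfree.1.sup_eq ▸ hWle, ?_, ?_⟩
  · rw [(Submodule.equivMapOfInjective ι.toLinearMap hprol.inj _).finrank_eq, hmap, hU,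
      ← (Submodule.equivMapOfInjective _ φ.injective _).finrank_eq,
      ← (Submodule.equivMapOfInjective ι.toLinearMap hprol.inj _).finrank_eq]
  · intro A he hf hA x hx
    obtain ⟨D, hD, hDA⟩ := hfree.exists_derivation A he hf hA
    have hle_e : e ≤ M.g (-1) := hfree.1.sup_eq ▸ le_sup_left
    have hle_f : f ≤ M.g (-1) := hfree.1.sup_eq ▸ le_sup_right
    obtain ⟨X, hX, hXD⟩ := hprol.exists_mem_zero hfree.1.fgla D hD
      (fun x hx => (hDA x (hle_e hx)).symm ▸ he x hx)
      (fun x hx => (hDA x (hle_f hx)).symm ▸ hf x hx)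
    rw [← hφ 0] at hX
    obtain ⟨Y, hY, rfl⟩ := hX
    obtain ⟨_, ⟨y, hy, rfl⟩, hyx⟩ := hx
    change ι (A x) ∈ U
    rw [← hDA x (hWle ⟨_, ⟨y, hy, rfl⟩, hyx⟩), ← hXD]
    refine ⟨_, hV Y hY y hy, ?_⟩
    change φ _ = _
    rw [LieEquiv.map_lie]
    exact congrArg _ hyx

/-- Every pair of automorphisms of `e` and `f` is the restriction of a linear map. -/
lemma exists_linearMap_extending {V : Type*} [AddCommGroup V] [Module ℂ V] {e f : Submodule ℂ V}
    (hd : e ⊓ f = ⊥) (ψe : e →ₗ[ℂ] e) (ψf : f →ₗ[ℂ] f) :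
    ∃ B : V →ₗ[ℂ] V, (∀ x : e, B x = ψe x) ∧ ∀ x : f, B x = ψf x := by
  have hd' : Disjoint e f := disjoint_iff.2 hd
  obtain ⟨C, hfC, hC⟩ := hd'.symm.exists_isCompl
  obtain ⟨C', heC', hC'⟩ := hd'.exists_isCompl
  refine ⟨e.subtype ∘ₗ ψe ∘ₗ e.projectionOnto C hC.symm +
    f.subtype ∘ₗ ψf ∘ₗ f.projectionOnto C' hC'.symm, fun x => ?_, fun x => ?_⟩
  · simp [(Submodule.projectionOnto_apply_eq_zero_iff hC'.symm).2 (heC' x.2)]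
  · simp [(Submodule.projectionOnto_apply_eq_zero_iff hC.symm).2 (hfC x.2)]

end Main

/-- Theorem 9.2: for the prolongation `g` of a free pseudo-product FGLA `(m; e, f)`,
the restriction map `Aut(g; e, f)₀ → GL(e) × GL(f)` is a group isomorphism; moreover
if `dim e ≠ dim f`, then `Aut(g; e, f)₀ = Aut(g)₀`. -/
theorem free_pp_fgla_prolongation_aut {Lm LG : Type} [LieRing Lm] [LieAlgebra ℂ Lm]
    [LieRing LG] [LieAlgebra ℂ LG]
    (M : GLA Lm) (e f : Submodule ℂ Lm) (m n μ : ℕ) (hμ : 2 ≤ μ)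
    (hfree : IsFreePPFGLA M e f m n μ)
    (G : GLA LG) (ι : Lm →ₗ⁅ℂ⁆ LG) (hprol : IsPPProlongation M e f G ι) :
    (∀ (ψe : e ≃ₗ[ℂ] e) (ψf : f ≃ₗ[ℂ] f),
      ∃! φ : LG ≃ₗ⁅ℂ⁆ LG,
        (∀ p : ℤ, (G.g p).map (φ : LG →ₗ⁅ℂ⁆ LG).toLinearMap = G.g p) ∧
        (e.map ι.toLinearMap).map (φ : LG →ₗ⁅ℂ⁆ LG).toLinearMap = e.map ι.toLinearMap ∧
        (f.map ι.toLinearMap).map (φ : LG →ₗ⁅ℂ⁆ LG).toLinearMap = f.map ι.toLinearMap ∧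
        (∀ x : e, φ (ι (x : Lm)) = ι ((ψe x : Lm))) ∧
        (∀ x : f, φ (ι (x : Lm)) = ι ((ψf x : Lm)))) ∧
    (Module.finrank ℂ e ≠ Module.finrank ℂ f →
      ∀ φ : LG ≃ₗ⁅ℂ⁆ LG,
        (∀ p : ℤ, (G.g p).map (φ : LG →ₗ⁅ℂ⁆ LG).toLinearMap = G.g p) →
        (e.map ι.toLinearMap).map (φ : LG →ₗ⁅ℂ⁆ LG).toLinearMap = e.map ι.toLinearMap ∧
        (f.map ι.toLinearMap).map (φ : LG →ₗ⁅ℂ⁆ LG).toLinearMap = f.map ι.toLinearMap) := by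
  obtain ⟨hpp, -⟩ := id hfree
  have hle_e : e ≤ M.g (-1) := hpp.sup_eq ▸ le_sup_left
  have hle_f : f ≤ M.g (-1) := hpp.sup_eq ▸ le_sup_right
  have := hpp.fgla.fd
  refine ⟨fun ψe ψf => ?_, fun hne φ hφ => ?_⟩
  · obtain ⟨B, hBe, hBf⟩ := exists_linearMap_extending hpp.inf_eq ψe.toLinearMap ψf.toLinearMap
    obtain ⟨Φ, hinj, hmap, hΦ⟩ := hfree.exists_lieHom B
      (fun x hx => hBe ⟨x, hx⟩ ▸ (ψe ⟨x, hx⟩).2) (fun x hx => hBf ⟨x, hx⟩ ▸ (ψf ⟨x, hx⟩).2)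
      (fun y hy => by
        rw [← hpp.sup_eq] at hy
        obtain ⟨a, ha, b, hb, rfl⟩ := Submodule.mem_sup.1 hy
        refine ⟨ψe.symm ⟨a, ha⟩ + ψf.symm ⟨b, hb⟩,
          add_mem (hle_e (ψe.symm ⟨a, ha⟩).2) (hle_f (ψf.symm ⟨b, hb⟩).2), ?_⟩
        rw [map_add, hBe, hBf]
        simp)
    have hΦe (x : e) : Φ x = ψe x := (hΦ x (hle_e x.2)).trans (hBe x)
    have hΦf (x : f) : Φ x = ψf x := (hΦ x (hle_f x.2)).trans (hBf x)
    have hmape : e.map Φ.toLinearMap = e := by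
      refine le_antisymm ?_ fun x hx => ⟨ψe.symm ⟨x, hx⟩, (ψe.symm ⟨x, hx⟩).2, ?_⟩
      · rintro _ ⟨x, hx, rfl⟩
        exact (hΦe ⟨x, hx⟩).symm ▸ (ψe ⟨x, hx⟩).2
      · exact (hΦe _).trans (by simp)
    have hmapf : f.map Φ.toLinearMap = f := by
      refine le_antisymm ?_ fun x hx => ⟨ψf.symm ⟨x, hx⟩, (ψf.symm ⟨x, hx⟩).2, ?_⟩
      · rintro _ ⟨x, hx, rfl⟩
        exact (hΦf ⟨x, hx⟩).symm ▸ (ψf ⟨x, hx⟩).2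
      · exact (hΦf _).trans (by simp)
    obtain ⟨φ, hφ, hφι⟩ := hprol.exists_lieEquiv Φ hinj hmap hmape hmapf
    have hφV (V : Submodule ℂ Lm) (hV : V.map Φ.toLinearMap = V) :
        (V.map ι.toLinearMap).map (φ : LG →ₗ⁅ℂ⁆ LG).toLinearMap = V.map ι.toLinearMap := by
      conv_rhs => rw [← hV]
      rw [← Submodule.map_comp, ← Submodule.map_comp]
      exact congrArg (fun g => V.map g) (LinearMap.ext hφι)
    refine ⟨φ, ⟨hφ, hφV e hmape, hφV f hmapf, fun x => by rw [hφι, hΦe],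
      fun x => by rw [hφι, hΦf]⟩, ?_⟩
    rintro φ' ⟨hφ', -, -, he', hf'⟩
    refine hprol.lieEquiv_ext hpp.fgla φ' φ hφ' hφ fun x hx => ?_
    rw [← hpp.sup_eq] at hx
    obtain ⟨a, ha, b, hb, rfl⟩ := Submodule.mem_sup.1 hx
    rw [map_add, map_add, map_add, he' ⟨a, ha⟩, hf' ⟨b, hb⟩, hφι a, hφι b, hΦe ⟨a, ha⟩,
      hΦf ⟨b, hb⟩]
  · obtain ⟨W, hW, hWle, hWr, hWst⟩ :=
      hprol.exists_map_eq hfree φ hφ e hle_e hprol.e_stable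
    obtain ⟨W', hW', hWle', hWr', hWst'⟩ :=
      hprol.exists_map_eq hfree φ hφ f hle_f hprol.f_stable
    rw [← hW, ← hW', eq_of_idempotent_stable hpp.inf_eq hWle hpp.f_ne_bot hWst hWr hne,
      eq_of_idempotent_stable (inf_comm e f ▸ hpp.inf_eq) (sup_comm e f ▸ hWle') hpp.e_ne_bot
        (fun A h₁ h₂ => hWst' A h₂ h₁) hWr' hne.symm]
    exact ⟨rfl, rfl⟩
end
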